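/- arXiv:1701.07155 — 2 statements merged into one kernel-verified Lean document; each statement's English description precedes it below -/
import Mathlib

section
/- In every cube tiling [0,1)^d + T of ℝ^d with d ≤ 6 there is a twin pair (Keller's conjecture holds in dimensions d ≤ 6). -/
/-- The half-open unit cube `[0,1)^d` translated by `t`. -/
def UnitCube (d : ℕ) (t : Fin d → ℝ) : Set (Fin d → ℝ) :=
  {x | ∀ i, t i ≤ x i ∧ x i < t i + 1}

/-- `[0,1)^d + T` is a cube tiling of `ℝ^d`: the cubes are pairwise disjoint and
cover `ℝ^d`, i.e. every point lies in exactly one cube of the family. -/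
def IsCubeTiling (d : ℕ) (T : Set (Fin d → ℝ)) : Prop :=
  ∀ x : Fin d → ℝ, ∃! t, t ∈ T ∧ x ∈ UnitCube d t

/-- The tiling determined by `T` contains a twin pair: two cubes whose translation
vectors differ by exactly `1` in one coordinate and agree in all others. -/
def HasTwinPair (d : ℕ) (T : Set (Fin d → ℝ)) : Prop :=
  ∃ t ∈ T, ∃ s ∈ T, ∃ j : Fin d, |t j - s j| = 1 ∧ ∀ i, i ≠ j → t i = s i


/-- Two cubes met by one line in direction `i` have congruent `i`-th coordinates. -/
theorem kel_line {d : ℕ} {T : Set (Fin d → ℝ)} (hT : IsCubeTiling d T) (i : Fin d)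
    {t s : Fin d → ℝ} (ht : t ∈ T) (hs : s ∈ T) (x : Fin d → ℝ)
    (hxt : ∀ j, j ≠ i → t j ≤ x j ∧ x j < t j + 1)
    (hxs : ∀ j, j ≠ i → s j ≤ x j ∧ x j < s j + 1) : ∃ n : ℤ, s i - t i = n := by
  have mem : ∀ (u : Fin d → ℝ) (y : ℝ), (∀ j, j ≠ i → u j ≤ x j ∧ x j < u j + 1) →
      u i ≤ y → y < u i + 1 → Function.update x i y ∈ UnitCube d u := by
    intro u y hu h1 h2 j
    by_cases hj : j = i
    · subst hj; simp [h1, h2]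
    · simp [hj]; exact hu j hj
  have mem' : ∀ (u : Fin d → ℝ) (y : ℝ), Function.update x i y ∈ UnitCube d u →
      (∀ j, j ≠ i → u j ≤ x j ∧ x j < u j + 1) ∧ u i ≤ y ∧ y < u i + 1 := by
    intro u y hu
    refine ⟨fun j hj => ?_, ?_⟩
    · have := hu j; simpa [hj] using this
    · have := hu i; simpa using this
  have uniq : ∀ (u v : Fin d → ℝ) (y : ℝ), u ∈ T → v ∈ T →
      (∀ j, j ≠ i → u j ≤ x j ∧ x j < u j + 1) → (∀ j, j ≠ i → v j ≤ x j ∧ x j < v j + 1) →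
      u i ≤ y → y < u i + 1 → v i ≤ y → y < v i + 1 → u = v := by
    intro u v y hu hv h1 h2 h3 h4 h5 h6
    exact (hT (Function.update x i y)).unique ⟨hu, mem u y h1 h3 h4⟩ ⟨hv, mem v y h2 h5 h6⟩
  have key : ∀ (t s : Fin d → ℝ), t ∈ T → s ∈ T →
      (∀ j, j ≠ i → t j ≤ x j ∧ x j < t j + 1) → (∀ j, j ≠ i → s j ≤ x j ∧ x j < s j + 1) →
      t i ≤ s i → ∃ n : ℤ, s i - t i = n := by
    intro t s ht hs hxt hxs hle
    have up : ∀ n : ℕ, ∃ u ∈ T, (∀ j, j ≠ i → u j ≤ x j ∧ x j < u j + 1) ∧ u i = t i + n := by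
      intro n
      induction n with
      | zero => exact ⟨t, ht, hxt, by simp⟩
      | succ n ih =>
        obtain ⟨u, hu, hux, hui⟩ := ih
        obtain ⟨v, ⟨hv, hvx⟩, -⟩ := hT (Function.update x i (u i + 1))
        obtain ⟨h1, h2, h3⟩ := mem' v _ hvx
        refine ⟨v, hv, h1, ?_⟩
        rcases h2.lt_or_eq with h | h
        · exfalso
          have : u = v := uniq u v (max (u i) (v i)) hu hv hux h1 (le_max_left _ _)
            (max_lt (by linarith) h) (le_max_right _ _) (max_lt (by linarith) (by linarith))
          rw [this] at h3; linarith
        · rw [h, hui]; push_cast; ring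
    obtain ⟨u, hu, hux, hui⟩ := up ⌊s i - t i⌋₊
    have h1 := Nat.floor_le (sub_nonneg.2 hle)
    have h2 := Nat.lt_floor_add_one (s i - t i)
    have : u = s := uniq u s (s i) hu hs hux hxs (by linarith) (by linarith) le_rfl (by linarith)
    refine ⟨⌊s i - t i⌋₊, ?_⟩
    rw [this] at hui
    push_cast; linarith
  rcases le_total (t i) (s i) with h | h
  · exact key t s ht hs hxt hxs h
  · obtain ⟨n, hn⟩ := key s t hs ht hxs hxt h
    exact ⟨-n, by push_cast; linarith⟩

/-- Shifting one residue class in direction `i`. -/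
theorem kel_shift {d : ℕ} {T : Set (Fin d → ℝ)} (hT : IsCubeTiling d T) (i : Fin d) (α δ : ℝ) :
    IsCubeTiling d {u | (u ∈ T ∧ ¬ ∃ n : ℤ, u i - α = n) ∨
      ∃ t ∈ T, (∃ n : ℤ, t i - α = n) ∧ u = Function.update t i (t i + δ)} := by
  intro x
  obtain ⟨t, ⟨ht, htx⟩, htu⟩ := hT x
  by_cases hc : ∃ n : ℤ, t i - α = n
  · obtain ⟨s, ⟨hs, hsx⟩, hsu⟩ := hT (Function.update x i (x i - δ))
    have hsx' : ∀ j, j ≠ i → s j ≤ x j ∧ x j < s j + 1 := by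
      intro j hj; have := hsx j; simpa [hj] using this
    have hsi := hsx i
    simp only [Function.update_self] at hsi
    have hsc : ∃ n : ℤ, s i - α = n := by
      obtain ⟨n, hn⟩ := kel_line hT i ht hs x (fun j _ => htx j) hsx'
      obtain ⟨m, hm⟩ := hc
      exact ⟨n + m, by push_cast; linarith⟩
    refine ⟨Function.update s i (s i + δ), ⟨Or.inr ⟨s, hs, hsc, rfl⟩, ?_⟩, ?_⟩
    · intro j
      by_cases hj : j = i
      · subst hj; simp only [Function.update_self]; constructor <;> linarith
      · simp only [Function.update_of_ne hj]; exact hsx' j hj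
    · rintro u ⟨(⟨hu, hun⟩ | ⟨v, hv, hvc, rfl⟩), hux⟩
      · exfalso
        rw [htu u ⟨hu, hux⟩] at hun
        exact hun hc
      · have : v = s := by
          apply hsu
          refine ⟨hv, fun j => ?_⟩
          have h := hux j
          by_cases hj : j = i
          · subst hj; simp only [Function.update_self] at h ⊢; constructor <;> linarith
          · simpa [hj] using h
        rw [this]
  · refine ⟨t, ⟨Or.inl ⟨ht, hc⟩, htx⟩, ?_⟩
    rintro u ⟨(⟨hu, hun⟩ | ⟨v, hv, hvc, rfl⟩), hux⟩
    · exact htu u ⟨hu, hux⟩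
    · exfalso
      apply hc
      obtain ⟨n, hn⟩ := kel_line hT i hv ht x (fun j hj => by
        have := hux j; simpa [hj] using this) (fun j _ => htx j)
      obtain ⟨m, hm⟩ := hvc
      exact ⟨n + m, by push_cast; linarith⟩

/-- Keller's theorem. -/
theorem kel_int {d : ℕ} (N : ℕ) : ∀ {T : Set (Fin d → ℝ)}, IsCubeTiling d T →
    ∀ t ∈ T, ∀ s ∈ T, t ≠ s → (Finset.univ.filter (fun i => t i ≠ s i)).card ≤ N →
    ∃ i, t i ≠ s i ∧ ∃ n : ℤ, t i - s i = n := by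
  induction N with
  | zero =>
    intro T hT t ht s hs hne hN
    exfalso
    apply hne
    funext i
    by_contra h
    have : i ∈ Finset.univ.filter (fun i => t i ≠ s i) := by simp [h]
    rw [Finset.card_eq_zero.1 (Nat.le_zero.1 hN)] at this
    simp at this
  | succ N ih =>
    intro T hT t ht s hs hne hN
    obtain ⟨i, hi⟩ := Function.ne_iff.1 hne
    by_cases hc : ∃ n : ℤ, t i - s i = n
    · exact ⟨i, hi, hc⟩
    have hT' := kel_shift hT i (t i) (s i - t i)
    have hsT' : s ∈ {u | (u ∈ T ∧ ¬ ∃ n : ℤ, u i - t i = n) ∨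
      ∃ t' ∈ T, (∃ n : ℤ, t' i - t i = n) ∧ u = Function.update t' i (t' i + (s i - t i))} := by
      left
      refine ⟨hs, ?_⟩
      rintro ⟨n, hn⟩
      exact hc ⟨-n, by push_cast; linarith⟩
    have htT' : Function.update t i (s i) ∈ {u | (u ∈ T ∧ ¬ ∃ n : ℤ, u i - t i = n) ∨
      ∃ t' ∈ T, (∃ n : ℤ, t' i - t i = n) ∧ u = Function.update t' i (t' i + (s i - t i))} := by
      right
      exact ⟨t, ht, ⟨0, by simp⟩, by congr 1; ring⟩
    have hne' : Function.update t i (s i) ≠ s := by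
      intro h
      apply hc
      have hj : ∀ j, j ≠ i → t j = s j := by
        intro j hj
        have := congrFun h j
        simpa [hj] using this
      obtain ⟨n, hn⟩ := kel_line hT i hs ht s (fun j hj => by constructor <;> linarith)
        (fun j h' => by rw [hj j h']; constructor <;> linarith)
      exact ⟨n, hn⟩
    obtain ⟨k, hk, n, hn⟩ := ih hT' _ htT' _ hsT' hne' (by
      apply Nat.le_of_lt_succ
      refine lt_of_lt_of_le (Finset.card_lt_card ?_) hN
      rw [Finset.ssubset_iff_of_subset]
      · exact ⟨i, by simp [hi], by simp⟩
      · intro j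
        by_cases hj : j = i
        · subst hj; simp
        · simp [hj])
    have hki : k ≠ i := by
      rintro rfl
      simp at hk
    simp only [Function.update_of_ne hki] at hk hn
    exact ⟨k, hk, n, hn⟩

/-- complementary letter -/
def kNeg {C : Type} (a : C × Bool) : C × Bool := (a.1, !a.2)

/-- Abstract twin-free tilings by words of length `d`. -/
structure KGood {C : Type} (d : ℕ) (T : Set (ℕ → C × Bool)) : Prop where
  cover : ∀ x : ℕ → C → Bool, ∃ w ∈ T, ∀ i < d, (w i).2 = x i (w i).1
  dich : ∀ v ∈ T, ∀ w ∈ T, (∀ i < d, v i = w i) ∨ ∃ i < d, v i = kNeg (w i)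
  notwin : ∀ v ∈ T, ∀ w ∈ T, ∀ j < d, v j = kNeg (w j) →
    (∀ i < d, i ≠ j → v i = w i) → False

theorem kel_good {d : ℕ} {T : Set (Fin d → ℝ)} (hT : IsCubeTiling d T)
    (hno : ¬ HasTwinPair d T) : ∃ T' : Set (ℕ → ℝ × Bool), KGood d T' := by
  have hex : ∀ v : Fin d → Bool, ∃ t ∈ T, ∀ i, t i ≤ (if v i then (1:ℝ) else 0) ∧
      (if v i then (1:ℝ) else 0) < t i + 1 := by
    intro v
    obtain ⟨t, ⟨ht, hx⟩, -⟩ := hT (fun i => if v i then (1:ℝ) else 0)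
    exact ⟨t, ht, hx⟩
  choose t htT ht using hex
  have hd : ∀ v w : Fin d → Bool, v ≠ w → ∃ i, v i ≠ w i ∧
      t v i - (if v i then (1:ℝ) else 0) = t w i - (if w i then (1:ℝ) else 0) := by
    intro v w hvw
    have hne : t v ≠ t w := by
      intro h
      obtain ⟨i, hi⟩ := Function.ne_iff.1 hvw
      have h1 := ht v i
      have h2 := ht w i
      rw [h] at h1
      cases hv : v i <;> cases hw : w i <;> simp [hv, hw] at h1 h2 hi <;> linarith
    obtain ⟨i, hi, n, hn⟩ := kel_int _ hT _ (htT v) _ (htT w) hne le_rfl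
    have h1 := ht v i
    have h2 := ht w i
    have hn0 : n ≠ 0 := by
      rintro rfl
      apply hi
      simp at hn
      linarith
    refine ⟨i, ?_, ?_⟩
    · intro h
      rw [h] at h1
      have a1 : (n : ℝ) < 1 := by linarith
      have a2 : (-1 : ℝ) < n := by linarith
      norm_cast at a1 a2
      omega
    · cases hv : v i <;> cases hw : w i <;> simp [hv, hw] at h1 h2 ⊢
      · have a1 : (n : ℝ) < 1 := by linarith
        have a2 : (-1 : ℝ) < n := by linarith
        norm_cast at a1 a2
        omega
      · have a1 : (n : ℝ) < 0 := by linarith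
        have a2 : (-2 : ℝ) < n := by linarith
        norm_cast at a1 a2
        have : n = -1 := by omega
        subst this
        push_cast at hn; linarith
      · have a1 : (n : ℝ) < 2 := by linarith
        have a2 : (0 : ℝ) < n := by linarith
        norm_cast at a1 a2
        have : n = 1 := by omega
        subst this
        push_cast at hn; linarith
      · have a1 : (n : ℝ) < 1 := by linarith
        have a2 : (-1 : ℝ) < n := by linarith
        norm_cast at a1 a2
        omega
  let wd : (Fin d → Bool) → ℕ → ℝ × Bool := fun v i =>
    if h : i < d then (t v ⟨i, h⟩ - (if v ⟨i, h⟩ then (1:ℝ) else 0), v ⟨i, h⟩) else (0, false)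
  have hwd : ∀ v (i : Fin d), wd v i = (t v i - (if v i then (1:ℝ) else 0), v i) := by
    intro v i; simp [wd]
  refine ⟨Set.range wd, ?_, ?_, ?_⟩
  · intro x
    let φ : (Fin d → Bool) → (Fin d → Bool) := fun v i =>
      xor (v i) (x i (t v i - (if v i then (1:ℝ) else 0)))
    have hinj : Function.Injective φ := by
      intro v w hvw
      by_contra hne
      obtain ⟨i, h1, h2⟩ := hd v w hne
      have := congrFun hvw i
      simp only [φ, h2] at this
      exact h1 (by simpa using this)
    obtain ⟨v, hv⟩ := Finite.injective_iff_surjective.1 hinj (fun _ => false)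
    refine ⟨wd v, ⟨v, rfl⟩, fun i hi => ?_⟩
    have := congrFun hv ⟨i, hi⟩
    have h2 := hwd v ⟨i, hi⟩
    simp only at h2
    rw [h2]
    simpa [φ] using this
  · rintro _ ⟨v, rfl⟩ _ ⟨w, rfl⟩
    by_cases h : v = w
    · left; rw [h]; simp
    · right
      obtain ⟨i, h1, h2⟩ := hd v w h
      refine ⟨i, i.2, ?_⟩
      rw [hwd, hwd, h2, kNeg]
      simp only [Prod.mk.injEq, true_and]
      cases hv : v i <;> cases hw : w i <;> simp_all
  · rintro _ ⟨v, rfl⟩ _ ⟨w, rfl⟩ j hj h1 h2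
    apply hno
    refine ⟨t v, htT v, t w, htT w, ⟨j, hj⟩, ?_, ?_⟩
    · have e1 := hwd v ⟨j, hj⟩
      have e2 := hwd w ⟨j, hj⟩
      simp only at e1 e2
      rw [e1, e2, kNeg] at h1
      simp only [Prod.mk.injEq] at h1
      obtain ⟨h3, h4⟩ := h1
      rw [h4] at h3
      cases hw : w ⟨j, hj⟩ <;> simp [hw] at h3
      · have : t v ⟨j, hj⟩ - t w ⟨j, hj⟩ = 1 := by linarith
        rw [this]; simp
      · have : t v ⟨j, hj⟩ - t w ⟨j, hj⟩ = -1 := by linarith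
        rw [this]; simp
    · intro i hi
      have e1 := hwd v i
      have e2 := hwd w i
      have h3 := h2 i i.2 (fun h => hi (Fin.ext h))
      rw [e1, e2] at h3
      simp only [Prod.mk.injEq] at h3
      obtain ⟨h3, h4⟩ := h3
      rw [h4] at h3
      linarith

inductive KCol where
  | nil : KCol
  | cons (p q : Nat) (t : KCol) : KCol

inductive KOpt where
  | nil : KOpt
  | cons (l e c : Nat) (t : KOpt) : KOpt

inductive KLv where
  | nil : KLv
  | cons (o : KOpt) (suf : Nat) (t : KLv) : KLv

inductive KSt where
  | mk (full : Nat) (cols : List KCol) : KSt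

inductive KLem where
  | mk (K : List Nat) (words : List Nat) (ops : List Nat) : KLem

inductive KTree where
  | leaf (l : KLem) : KTree
  | node (a b : KTree) : KTree

noncomputable section

def kAddCol (c : KCol) : Nat → Nat → KCol :=
  KCol.rec (motive := fun _ => Nat → Nat → KCol)
    (fun _ bit => .cons bit 0 .nil)
    (fun p q t ih l bit =>
      Nat.rec (motive := fun _ => KCol) (.cons (Nat.lor p bit) q t)
        (fun l1 _ => Nat.rec (motive := fun _ => KCol) (.cons p (Nat.lor q bit) t)
          (fun l2 _ => .cons p q (ih l2 bit)) l1) l) c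

def kOpts (c : KCol) : Nat → Nat → KOpt :=
  KCol.rec (motive := fun _ => Nat → Nat → KOpt)
    (fun _ l => .cons l 0 0 .nil)
    (fun a b _ ih p l => Nat.rec (motive := fun _ => KOpt)
      (.cons l a b (ih (Nat.div p 2) (Nat.add l 2)))
      (fun _ _ => .cons (Nat.add l 1) b a (ih (Nat.div p 2) (Nat.add l 2))) (Nat.mod p 2)) c

def kShc (c : KCol) : Nat → Nat :=
  KCol.rec (motive := fun _ => Nat → Nat) (fun p => p) (fun _ _ _ ih p => ih (Nat.div p 2)) c

def kOrC (o : KOpt) : Nat :=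
  KOpt.rec (motive := fun _ => Nat) 0 (fun _ _ c _ ih => Nat.lor c ih) o

def kOrE (o : KOpt) : Nat :=
  KOpt.rec (motive := fun _ => Nat) 0 (fun _ e _ _ ih => Nat.lor e ih) o

def kTop (v : KLv) : Nat :=
  KLv.rec (motive := fun _ => Nat) 0 (fun o s _ _ => Nat.lor (kOrC o) s) v

def kMkLv (cols : List KCol) : Nat → KLv :=
  List.rec (motive := fun _ => Nat → KLv) (fun _ => .nil)
    (fun c _ ih p => .cons (kOpts c p 0) (kTop (ih (kShc c p))) (ih (kShc c p))) cols

def kCov (v : KLv) : Nat → Nat :=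
  KLv.rec (motive := fun _ => Nat → Nat) (fun m => m)
    (fun o _ _ ih m => ih (Nat.land m (kOrE o))) v

def kAddW (cols : List KCol) : List Nat → Nat → List KCol :=
  List.rec (motive := fun _ => List Nat → Nat → List KCol) (fun _ _ => [])
    (fun c t ih w bit => List.rec (motive := fun _ => List KCol) (c :: t)
      (fun l w' _ => kAddCol c l bit :: ih w' bit) w) cols

def kApp (a b : List KSt) : List KSt :=
  List.rec (motive := fun _ => List KSt) b (fun x _ ih => x :: ih) a

def kDfs (full : Nat) (v : KLv) : Nat → Nat → Nat → (List Nat → KSt) → List KSt :=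
  KLv.rec (motive := fun _ => Nat → Nat → Nat → (List Nat → KSt) → List KSt)
    (fun _ _ Tw k => Nat.rec (motive := fun _ => List KSt) [k []] (fun _ _ => []) Tw)
    (fun o suf _ ih m E Tw k => KOpt.rec (motive := fun _ => List KSt) []
      (fun l e c _ iho => Bool.rec (motive := fun _ => List KSt) iho
        (kApp (ih (Nat.lor m c) (Nat.land E e) (Nat.lor (Nat.land Tw e) (Nat.land E c))
          (fun w => k (l :: w))) iho)
        (Nat.beq (Nat.lor (Nat.lor m c) suf) full)) o) v

def kGetCol (cols : List KCol) : Nat → KCol :=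
  List.rec (motive := fun _ => Nat → KCol) (fun _ => .nil)
    (fun c _ ih i => Nat.rec (motive := fun _ => KCol) c (fun j _ => ih j) i) cols

/-- letter lookup, continuation style -/
def kLk (c : KCol) : Nat → (Nat → Nat → Bool) → Bool :=
  KCol.rec (motive := fun _ => Nat → (Nat → Nat → Bool) → Bool) (fun _ _ => false)
    (fun p q _ ih l k => Nat.rec (motive := fun _ => Bool) (k p q)
        (fun l1 _ => Nat.rec (motive := fun _ => Bool) (k q p)
          (fun l2 _ => ih l2 k) l1) l) c

def kLkm (c : KCol) : Nat → Nat :=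
  KCol.rec (motive := fun _ => Nat → Nat) (fun _ => 0)
    (fun p q _ ih l => Nat.rec (motive := fun _ => Nat) p
        (fun l1 _ => Nat.rec (motive := fun _ => Nat) q
          (fun l2 _ => ih l2) l1) l) c

def kTrC (col : KCol) (n : Nat) : Nat → Nat → (Nat → KCol → Bool) → Bool :=
  Nat.rec (motive := fun _ => Nat → Nat → (Nat → KCol → Bool) → Bool)
    (fun code _ k => k code .nil)
    (fun _ ih code used k =>
      Nat.rec (motive := fun _ => Bool)
        (kLk col (Nat.mod code 16) (fun p q =>
          ih (Nat.div code 16) (Nat.lor used (Nat.pow 2 (Nat.div (Nat.mod code 16) 2)))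
            (fun code' t => k code' (.cons p q t))))
        (fun _ _ => false)
        (Nat.land used (Nat.pow 2 (Nat.div (Nat.mod code 16) 2)))) n

def kTr (cols : List KCol) (pfull : Nat) (K : List Nat) :
    Nat → Nat → (List KCol → Bool) → Bool :=
  List.rec (motive := fun _ => Nat → Nat → (List KCol → Bool) → Bool)
    (fun _ pm k => Bool.rec (motive := fun _ => Bool) false (k []) (Nat.beq pm pfull))
    (fun n _ ih code pm k =>
      kTrC (kGetCol cols (Nat.mod code 8)) n (Nat.div code 8) 0 (fun code' c =>
        ih code' (Nat.lor pm (Nat.pow 2 (Nat.mod code 8))) (fun cs => k (c :: cs)))) K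

def kWord (cs : List KCol) : Nat → Nat → Bool :=
  List.rec (motive := fun _ => Nat → Nat → Bool)
    (fun _ m => Nat.rec (motive := fun _ => Bool) false (fun _ _ => true) m)
    (fun c _ ih w m => ih (Nat.div w 16) (Nat.land m (kLkm c (Nat.mod w 16)))) cs

def kWords (cs : List KCol) (full : Nat) (ws : List Nat) : Bool :=
  List.rec (motive := fun _ => Bool) true
    (fun w _ ih => Bool.rec (motive := fun _ => Bool) false ih (kWord cs w full)) ws

def kGet (t : KTree) : Nat → KLem :=
  KTree.rec (motive := fun _ => Nat → KLem) (fun l _ => l)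
    (fun _ _ iha ihb i => Nat.rec (motive := fun _ => KLem) (iha (Nat.div i 2))
      (fun _ _ => ihb (Nat.div i 2)) (Nat.mod i 2)) t

def kLen (c : KCol) : Nat := KCol.rec (motive := fun _ => Nat) 0 (fun _ _ _ ih => Nat.succ ih) c

def kRef (d : Nat) (tab : KTree) (j full : Nat) (cols : List KCol) (o : Nat) : Bool :=
  Bool.rec (motive := fun _ => Bool) false
    (KLem.rec (motive := fun _ => Bool)
      (fun K ws _ => Bool.rec (motive := fun _ => Bool) false
        (kTr cols (Nat.sub (Nat.pow 2 d) 1) K (Nat.div o 256) 0 (fun cs => kWords cs full ws))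
        (Nat.beq (List.rec (motive := fun _ => Nat) 0 (fun _ _ ih => Nat.succ ih) K) d))
      (kGet tab (Nat.mod o 256)))
    (Nat.ble (Nat.succ (Nat.mod o 256)) j)

def kLoop (d : Nat) (tab : KTree) (j : Nat) (ops : List Nat) : List KSt → Bool :=
  List.rec (motive := fun _ => List KSt → Bool)
    (fun st => List.rec (motive := fun _ => Bool) true (fun _ _ _ => false) st)
    (fun o _ ih st => List.rec (motive := fun _ => Bool) false
      (fun S rest _ => KSt.rec (motive := fun _ => Bool) (fun full cols =>
        Nat.rec (motive := fun _ => Bool)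
          (Nat.rec (motive := fun _ => Bool)
            (ih (kApp (kDfs full (kMkLv cols (Nat.div o 2)) 0 full 0
              (fun w => .mk (Nat.succ (Nat.mul 2 full)) (kAddW cols w (Nat.succ full)))) rest))
            (fun _ _ => false)
            (kCov (kMkLv cols (Nat.div o 2)) full))
          (fun _ _ => Bool.rec (motive := fun _ => Bool) false (ih rest)
            (kRef d tab j full cols (Nat.div o 2)))
          (Nat.mod o 2)) S) st) ops

def kDig (n : Nat) : Nat → List Nat :=
  Nat.rec (motive := fun _ => Nat → List Nat) (fun _ => [])
    (fun _ ih w => Nat.mod w 16 :: ih (Nat.div w 16)) n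

def kOkW (cols : List KCol) : Nat → Bool :=
  List.rec (motive := fun _ => Nat → Bool) (fun _ => true)
    (fun c _ ih w => Bool.rec (motive := fun _ => Bool) false (ih (Nat.div w 16))
      (Nat.ble (Nat.mod w 16) (Nat.mul 2 (kLen c)))) cols

def kBuild (d : Nat) (k : Nat → List KCol → Bool) (ws : List Nat) : Nat → List KCol → Bool :=
  List.rec (motive := fun _ => Nat → List KCol → Bool) k
    (fun w _ ih full cols => Bool.rec (motive := fun _ => Bool) false
      (ih (Nat.succ (Nat.mul 2 full)) (kAddW cols (kDig d w) (Nat.succ full)))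
      (kOkW cols w)) ws

def kNils (d : Nat) : List KCol :=
  Nat.rec (motive := fun _ => List KCol) [] (fun _ ih => KCol.nil :: ih) d

def kChk1 (d : Nat) (tab : KTree) (j : Nat) : Bool :=
  KLem.rec (motive := fun _ => Bool)
    (fun _ ws ops => kBuild d (fun full cols => kLoop d tab j ops [.mk full cols]) ws 0 (kNils d))
    (kGet tab j)

def kChk (d : Nat) (tab : KTree) (lo n : Nat) : Bool :=
  Nat.rec (motive := fun _ => Bool) true
    (fun i ih => Bool.rec (motive := fun _ => Bool) false ih (kChk1 d tab (Nat.add lo i))) n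

end

section KSem

variable {C : Type}

theorem kNeg_neg (a : C × Bool) : kNeg (kNeg a) = a := by simp [kNeg]

theorem kNeg_fst (a : C × Bool) : (kNeg a).1 = a.1 := rfl

theorem kNeg_ne (a : C × Bool) : kNeg a ≠ a := by
  intro h
  have := congrArg Prod.snd h
  simp [kNeg] at this

theorem eq_or_kNeg {a b : C × Bool} (h : a.1 = b.1) : a = b ∨ a = kNeg b := by
  obtain ⟨a1, a2⟩ := a
  obtain ⟨b1, b2⟩ := b
  cases a2 <;> cases b2 <;> simp_all [kNeg]

/-- `a` is the letter numbered `l` with respect to the list of positive letters `R`. -/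
def LkR : List (C × Bool) → ℕ → C × Bool → Prop
  | [], _, _ => False
  | r :: _, 0, a => a = r
  | r :: _, 1, a => a = kNeg r
  | _ :: R, l + 2, a => LkR R l a

def KNd (R : List (C × Bool)) : Prop := (R.map Prod.fst).Nodup

def ColInv (n : ℕ) (u : ℕ → C × Bool) : KCol → List (C × Bool) → Prop
  | .nil, [] => True
  | .cons p q t, r :: R => (∀ x, p.testBit x = true ↔ x < n ∧ u x = r) ∧
      (∀ x, q.testBit x = true ↔ x < n ∧ u x = kNeg r) ∧ ColInv n u t R
  | _, _ => False

theorem LkR_mem : ∀ {R : List (C × Bool)} {l : ℕ} {a : C × Bool}, LkR R l a →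
    a.1 ∈ R.map Prod.fst
  | r :: R, 0, a, h => by simp [LkR] at h; simp [h]
  | r :: R, 1, a, h => by simp [LkR] at h; simp [h, kNeg]
  | r :: R, l + 2, a, h => by
    have := LkR_mem (R := R) (l := l) (a := a) h
    simp only [List.map_cons, List.mem_cons]; exact Or.inr this

theorem colInv_len {n : ℕ} {u : ℕ → C × Bool} : ∀ {c : KCol} {R : List (C × Bool)},
    ColInv n u c R → kLen c = R.length
  | .nil, [], _ => rfl
  | .cons p q t, r :: R, h => by
    have := colInv_len h.2.2
    show Nat.succ (kLen t) = _
    rw [this]; rfl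
  | .nil, _ :: _, h => h.elim
  | .cons _ _ _, [], h => h.elim

theorem testBit_lor_pow (p n x : ℕ) :
    (Nat.lor p (2 ^ n)).testBit x = true ↔ p.testBit x = true ∨ x = n := by
  show (p ||| 2 ^ n).testBit x = true ↔ _
  rw [Nat.testBit_or, Nat.testBit_two_pow, Bool.or_eq_true, decide_eq_true_eq, @eq_comm _ n x]

/-- one coordinate update -/
theorem spec_add {n : ℕ} {u u' : ℕ → C × Bool} (h : ∀ x < n, u' x = u x)
    {p : ℕ} {r : C × Bool} (hp : ∀ x, p.testBit x = true ↔ x < n ∧ u x = r) :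
    (u' n = r → ∀ x, (Nat.lor p (2 ^ n)).testBit x = true ↔ x < n + 1 ∧ u' x = r) ∧
    (u' n ≠ r → ∀ x, p.testBit x = true ↔ x < n + 1 ∧ u' x = r) := by
  constructor
  · intro hr x
    rw [testBit_lor_pow, hp]
    constructor
    · rintro (⟨h1, h2⟩ | rfl)
      · exact ⟨by omega, by rw [h x h1, h2]⟩
      · exact ⟨by omega, hr⟩
    · rintro ⟨h1, h2⟩
      by_cases hx : x = n
      · exact Or.inr hx
      · have : x < n := by omega
        exact Or.inl ⟨this, by rw [← h x this, h2]⟩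
  · intro hr x
    rw [hp]
    constructor
    · rintro ⟨h1, h2⟩
      exact ⟨by omega, by rw [h x h1, h2]⟩
    · rintro ⟨h1, h2⟩
      by_cases hx : x = n
      · subst hx; exact absurd h2 hr
      · have : x < n := by omega
        exact ⟨this, by rw [← h x this, h2]⟩

theorem colInv_mono {n : ℕ} {u u' : ℕ → C × Bool} (h : ∀ x < n, u' x = u x) :
    ∀ {c : KCol} {R : List (C × Bool)}, ColInv n u c R → (u' n).1 ∉ R.map Prod.fst →
    ColInv (n + 1) u' c R
  | .nil, [], _, _ => trivial
  | .cons p q t, r :: R, hc, hn => by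
    simp only [List.map_cons, List.mem_cons, not_or] at hn
    refine ⟨(spec_add h hc.1).2 (fun e => hn.1 (by rw [e])),
      (spec_add h hc.2.1).2 (fun e => hn.1 (by rw [e]; rfl)), colInv_mono h hc.2.2 hn.2⟩
  | .nil, _ :: _, hc, _ => hc.elim
  | .cons _ _ _, [], hc, _ => hc.elim

theorem colInv_add {n : ℕ} {u u' : ℕ → C × Bool} (h : ∀ x < n, u' x = u x) :
    ∀ {c : KCol} {R : List (C × Bool)} {l : ℕ}, ColInv n u c R → KNd R →
    LkR R l (u' n) → ColInv (n + 1) u' (kAddCol c l (2 ^ n)) R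
  | .nil, [], _, _, _, hl => hl.elim
  | .cons p q t, r :: R, 0, hc, hd, hl => by
    simp only [KNd, List.map_cons, List.nodup_cons] at hd
    have hl : u' n = r := hl
    show ColInv (n + 1) u' (.cons (Nat.lor p (2 ^ n)) q t) (r :: R)
    exact ⟨(spec_add h hc.1).1 hl, (spec_add h hc.2.1).2 (by rw [hl]; exact (kNeg_ne r).symm),
      colInv_mono h hc.2.2 (by rw [hl]; exact hd.1)⟩
  | .cons p q t, r :: R, 1, hc, hd, hl => by
    simp only [KNd, List.map_cons, List.nodup_cons] at hd
    have hl : u' n = kNeg r := hl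
    show ColInv (n + 1) u' (.cons p (Nat.lor q (2 ^ n)) t) (r :: R)
    exact ⟨(spec_add h hc.1).2 (by rw [hl]; exact (kNeg_ne r)), (spec_add h hc.2.1).1 hl,
      colInv_mono h hc.2.2 (by rw [hl]; exact hd.1)⟩
  | .cons p q t, r :: R, l + 2, hc, hd, hl => by
    simp only [KNd, List.map_cons, List.nodup_cons] at hd
    have hl : LkR R l (u' n) := hl
    show ColInv (n + 1) u' (.cons p q (kAddCol t l (2 ^ n))) (r :: R)
    have hm := LkR_mem hl
    have hne : (u' n).1 ≠ r.1 := fun e => hd.1 (by rw [← e]; exact hm)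
    exact ⟨(spec_add h hc.1).2 (fun e => hne (by rw [e])),
      (spec_add h hc.2.1).2 (fun e => hne (by rw [e]; rfl)), colInv_add h hc.2.2 hd.2 hl⟩
  | .nil, _ :: _, _, hc, _, _ => hc.elim
  | .cons _ _ _, [], _, hc, _, _ => hc.elim

theorem colInv_fresh {n : ℕ} {u u' : ℕ → C × Bool} (h : ∀ x < n, u' x = u x)
    (hu : ∀ x < n, (u x).1 ≠ (u' n).1) :
    ∀ {c : KCol} {R : List (C × Bool)} {l : ℕ}, ColInv n u c R →
    (u' n).1 ∉ R.map Prod.fst → l = 2 * R.length →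
    ColInv (n + 1) u' (kAddCol c l (2 ^ n)) (R ++ [u' n])
  | .nil, [], l, _, _, _ => by
    show ColInv (n + 1) u' (.cons (2 ^ n) 0 .nil) [u' n]
    refine ⟨fun x => ?_, fun x => ?_, trivial⟩
    · rw [Nat.testBit_two_pow]
      constructor
      · intro e
        have e : n = x := by simpa using e
        subst e; exact ⟨by omega, rfl⟩
      · rintro ⟨h1, h2⟩
        by_cases hx : x = n
        · simp [hx]
        · exfalso
          have : x < n := by omega
          apply hu x this
          rw [← h x this, h2]
    · simp only [Nat.zero_testBit, Bool.false_eq_true, false_iff, not_and]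
      intro h1 h2
      by_cases hx : x = n
      · subst hx; exact kNeg_ne _ h2.symm
      · have : x < n := by omega
        apply hu x this
        rw [← h x this, h2]; rfl
  | .cons p q t, r :: R, l, hc, hn, hl => by
    obtain ⟨l, rfl⟩ : ∃ l', l = l' + 2 := ⟨2 * R.length, by rw [hl]; simp; ring⟩
    have hl' : l = 2 * R.length := by simp at hl; omega
    simp only [List.map_cons, List.mem_cons, not_or] at hn
    show ColInv (n + 1) u' (.cons p q (kAddCol t l (2 ^ n))) (r :: (R ++ [u' n]))
    exact ⟨(spec_add h hc.1).2 (fun e => hn.1 (by rw [e])),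
      (spec_add h hc.2.1).2 (fun e => hn.1 (by rw [e]; rfl)),
      colInv_fresh h hu hc.2.2 hn.2 hl'⟩
  | .nil, _ :: _, _, hc, _, _ => hc.elim
  | .cons _ _ _, [], _, hc, _, _ => hc.elim

/-- full invariant of one column -/
def CI (n : ℕ) (u : ℕ → C × Bool) (c : KCol) (R : List (C × Bool)) : Prop :=
  ColInv n u c R ∧ KNd R ∧ ∀ x < n, (u x).1 ∈ R.map Prod.fst

theorem ci_add {n : ℕ} {u u' : ℕ → C × Bool} (h : ∀ x < n, u' x = u x) {c : KCol}
    {R : List (C × Bool)} {l : ℕ} (hc : CI n u c R) (hl : LkR R l (u' n)) :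
    CI (n + 1) u' (kAddCol c l (2 ^ n)) R := by
  refine ⟨colInv_add h hc.1 hc.2.1 hl, hc.2.1, fun x hx => ?_⟩
  by_cases hxn : x = n
  · subst hxn; exact LkR_mem hl
  · rw [h x (by omega)]; exact hc.2.2 x (by omega)

theorem ci_fresh {n : ℕ} {u u' : ℕ → C × Bool} (h : ∀ x < n, u' x = u x) {c : KCol}
    {R : List (C × Bool)} {l : ℕ} (hc : CI n u c R) (hn : (u' n).1 ∉ R.map Prod.fst)
    (hl : l = 2 * R.length) :
    CI (n + 1) u' (kAddCol c l (2 ^ n)) (R ++ [u' n]) := by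
  refine ⟨colInv_fresh h (fun x hx e => hn (by rw [← e]; exact hc.2.2 x hx)) hc.1 hn hl, ?_, ?_⟩
  · have := hc.2.1
    simp only [KNd, List.map_append, List.map_cons, List.map_nil] at this ⊢
    rw [List.nodup_append]
    refine ⟨this, by simp, ?_⟩
    intro a ha b hb e
    simp only [List.mem_singleton] at hb
    subst hb; subst e; exact hn ha
  · intro x hx
    by_cases hxn : x = n
    · subst hxn; simp
    · rw [h x (by omega), List.map_append, List.mem_append]
      exact Or.inl (hc.2.2 x (by omega))

def OptMem (l e c : ℕ) : KOpt → Prop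
  | .nil => False
  | .cons l' e' c' t => (l = l' ∧ e = e' ∧ c = c') ∨ OptMem l e c t

theorem opt_orC {l e c : ℕ} : ∀ {o : KOpt}, OptMem l e c o → ∀ x, c.testBit x = true →
    (kOrC o).testBit x = true
  | .cons l' e' c' t, h, x, hx => by
    show (c' ||| kOrC t).testBit x = true
    rw [Nat.testBit_or, Bool.or_eq_true]
    rcases h with ⟨-, -, rfl⟩ | h
    · exact Or.inl hx
    · exact Or.inr (opt_orC h x hx)

theorem opt_orE {l e c : ℕ} : ∀ {o : KOpt}, OptMem l e c o → ∀ x, e.testBit x = true →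
    (kOrE o).testBit x = true
  | .cons l' e' c' t, h, x, hx => by
    show (e' ||| kOrE t).testBit x = true
    rw [Nat.testBit_or, Bool.or_eq_true]
    rcases h with ⟨-, rfl, -⟩ | h
    · exact Or.inl hx
    · exact Or.inr (opt_orE h x hx)

theorem kOpts_cons (a b : ℕ) (t : KCol) (p l : ℕ) : kOpts (.cons a b t) p l =
    if p % 2 = 0 then .cons l a b (kOpts t (p / 2) (l + 2))
    else .cons (l + 1) b a (kOpts t (p / 2) (l + 2)) := by
  have h : kOpts (.cons a b t) p l = Nat.rec (motive := fun _ => KOpt)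
      (.cons l a b (kOpts t (p / 2) (l + 2)))
      (fun _ _ => .cons (l + 1) b a (kOpts t (p / 2) (l + 2))) (p % 2) := rfl
  rw [h]
  cases p % 2 <;> simp

theorem kOrC_lt {n : ℕ} {u : ℕ → C × Bool} : ∀ {c : KCol} {R : List (C × Bool)},
    ColInv n u c R → ∀ p l x, (kOrC (kOpts c p l)).testBit x = true → x < n
  | .nil, [], _, p, l, x, h => by
    have h : Nat.testBit (0 ||| 0) x = true := h
    simp at h
  | .cons a b t, r :: R, hc, p, l, x, h => by
    rw [kOpts_cons] at h
    split_ifs at h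
    · have h : (b ||| kOrC (kOpts t (p / 2) (l + 2))).testBit x = true := h
      rw [Nat.testBit_or, Bool.or_eq_true] at h
      rcases h with h | h
      · exact ((hc.2.1 x).1 h).1
      · exact kOrC_lt hc.2.2 _ _ x h
    · have h : (a ||| kOrC (kOpts t (p / 2) (l + 2))).testBit x = true := h
      rw [Nat.testBit_or, Bool.or_eq_true] at h
      rcases h with h | h
      · exact ((hc.1 x).1 h).1
      · exact kOrC_lt hc.2.2 _ _ x h
  | .nil, _ :: _, hc, _, _, _, _ => hc.elim
  | .cons _ _ _, [], hc, _, _, _, _ => hc.elim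

open Classical in
theorem opts_spec {n : ℕ} {u : ℕ → C × Bool} : ∀ {c : KCol} {R : List (C × Bool)},
    ColInv n u c R → KNd R → ∀ p l0, ∃ x : C → Bool, ∀ a : C × Bool, a.2 = x a.1 →
    ∃ l e f, OptMem (l0 + l) e f (kOpts c p l0) ∧
      ((LkR R l a ∧ (∀ y, e.testBit y = true ↔ y < n ∧ u y = a) ∧
        (∀ y, f.testBit y = true ↔ y < n ∧ u y = kNeg a)) ∨
       (a.1 ∉ R.map Prod.fst ∧ l = 2 * R.length ∧ e = 0 ∧ f = 0))
  | .nil, [], _, _, p, l0 => by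
    refine ⟨fun _ => false, fun a _ => ⟨0, 0, 0, Or.inl ⟨rfl, rfl, rfl⟩, Or.inr ?_⟩⟩
    simp
  | .cons p' q' t, r :: R, hc, hd, p, l0 => by
    simp only [KNd, List.map_cons, List.nodup_cons] at hd
    obtain ⟨x, hx⟩ := opts_spec hc.2.2 hd.2 (p / 2) (l0 + 2)
    rw [kOpts_cons]
    have step : ∀ a : C × Bool, a.1 ≠ r.1 → a.2 = x a.1 → ∃ l e f,
        OptMem (l0 + l) e f (kOpts t (p / 2) (l0 + 2)) ∧
      ((LkR (r :: R) l a ∧ (∀ y, e.testBit y = true ↔ y < n ∧ u y = a) ∧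
        (∀ y, f.testBit y = true ↔ y < n ∧ u y = kNeg a)) ∨
       (a.1 ∉ (r :: R).map Prod.fst ∧ l = 2 * (r :: R).length ∧ e = 0 ∧ f = 0)) := by
      intro a hne ha
      obtain ⟨l, e, f, hm, h⟩ := hx a ha
      refine ⟨l + 2, e, f, by rw [show l0 + (l + 2) = l0 + 2 + l by omega]; exact hm, ?_⟩
      rcases h with h | ⟨h1, h2, h3⟩
      · exact Or.inl h
      · refine Or.inr ⟨?_, ?_, h3⟩
        · simp only [List.map_cons, List.mem_cons, not_or]; exact ⟨hne, h1⟩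
        · simp; omega
    split_ifs with hp
    · refine ⟨fun c => if c = r.1 then r.2 else x c, fun a ha => ?_⟩
      replace ha : a.2 = if a.1 = r.1 then r.2 else x a.1 := ha
      by_cases hr : a.1 = r.1
      · rw [if_pos hr] at ha
        have : a = r := Prod.ext hr ha
        subst this
        exact ⟨0, p', q', Or.inl ⟨rfl, rfl, rfl⟩, Or.inl ⟨rfl, hc.1, hc.2.1⟩⟩
      · rw [if_neg hr] at ha
        obtain ⟨l, e, f, hm, h⟩ := step a hr ha
        exact ⟨l, e, f, Or.inr hm, h⟩
    · refine ⟨fun c => if c = r.1 then !r.2 else x c, fun a ha => ?_⟩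
      replace ha : a.2 = if a.1 = r.1 then !r.2 else x a.1 := ha
      by_cases hr : a.1 = r.1
      · rw [if_pos hr] at ha
        have : a = kNeg r := Prod.ext hr ha
        subst this
        exact ⟨1, q', p', Or.inl ⟨rfl, rfl, rfl⟩,
          Or.inl ⟨rfl, hc.2.1, by rw [kNeg_neg]; exact hc.1⟩⟩
      · rw [if_neg hr] at ha
        obtain ⟨l, e, f, hm, h⟩ := step a hr ha
        exact ⟨l, e, f, Or.inr hm, h⟩
  | .nil, _ :: _, hc, _, _, _ => hc.elim
  | .cons _ _ _, [], hc, _, _, _ => hc.elim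

end KSem

section KSem2

variable {C : Type}

/-- invariant of all columns -/
def CsInv (n : ℕ) : (ℕ → ℕ → C × Bool) → List KCol → List (List (C × Bool)) → Prop
  | _, [], [] => True
  | W, c :: t, R :: Rs => CI n (fun x => W x 0) c R ∧ CsInv n (fun x i => W x (i + 1)) t Rs
  | _, _, _ => False

/-- a word (as a list of letters) passing through the options -/
def PathOK (n : ℕ) : (ℕ → ℕ → C × Bool) → (ℕ → C × Bool) → KLv → List ℕ → Prop
  | _, _, .nil, [] => True
  | W, a, .cons o s t, l :: ls =>
      (∃ e f, OptMem l e f o ∧ (∀ y, e.testBit y = true ↔ y < n ∧ W y 0 = a 0) ∧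
        (∀ y, f.testBit y = true ↔ y < n ∧ W y 0 = kNeg (a 0))) ∧
      (∀ y, s.testBit y = true → y < n) ∧
      (∀ y < n, (∃ i < ls.length, W y (i + 1) = kNeg (a (i + 1))) → s.testBit y = true) ∧
      PathOK n (fun x i => W x (i + 1)) (fun i => a (i + 1)) t ls
  | _, _, _, _ => False

theorem kTop_lt {n : ℕ} : ∀ {cols : List KCol} {W : ℕ → ℕ → C × Bool}
    {Rs : List (List (C × Bool))}, CsInv n W cols Rs →
    ∀ p y, (kTop (kMkLv cols p)).testBit y = true → y < n
  | [], W, [], _, p, y, h => by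
    have h : Nat.testBit 0 y = true := h
    simp at h
  | c :: t, W, R :: Rs, hc, p, y, h => by
    have h : (kOrC (kOpts c p 0) ||| kTop (kMkLv t (kShc c p))).testBit y = true := h
    rw [Nat.testBit_or, Bool.or_eq_true] at h
    rcases h with h | h
    · exact kOrC_lt hc.1.1 _ _ _ h
    · exact kTop_lt hc.2 _ _ h
  | [], W, _ :: _, hc, p, y, h => hc.elim
  | _ :: _, W, [], hc, p, y, h => hc.elim

theorem path_top {n : ℕ} : ∀ {v : KLv} {W : ℕ → ℕ → C × Bool} {a : ℕ → C × Bool}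
    {ls : List ℕ}, PathOK n W a v ls → ∀ y < n,
    (∃ i < ls.length, W y i = kNeg (a i)) → (kTop v).testBit y = true
  | .nil, W, a, [], _, y, hy, ⟨i, hi, _⟩ => by simp at hi
  | .cons o s t, W, a, l :: ls, h, y, hy, ⟨i, hi, he⟩ => by
    show (kOrC o ||| s).testBit y = true
    rw [Nat.testBit_or, Bool.or_eq_true]
    cases i with
    | zero =>
      obtain ⟨e, f, h1, h2, h3⟩ := h.1
      exact Or.inl (opt_orC h1 y ((h3 y).2 ⟨hy, he⟩))
    | succ i =>
      exact Or.inr (h.2.2.1 y hy ⟨i, by simpa using hi, he⟩)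

theorem path_cov {n : ℕ} : ∀ {v : KLv} {W : ℕ → ℕ → C × Bool} {a : ℕ → C × Bool}
    {ls : List ℕ} {m : ℕ}, PathOK n W a v ls → ∀ y < n, m.testBit y = true →
    (∀ i < ls.length, W y i = a i) → (kCov v m).testBit y = true
  | .nil, W, a, [], m, _, y, hy, hm, _ => hm
  | .cons o s t, W, a, l :: ls, m, h, y, hy, hm, he => by
    show (kCov t (m &&& kOrE o)).testBit y = true
    obtain ⟨e, f, h1, h2, h3⟩ := h.1
    refine path_cov h.2.2.2 y hy ?_ (fun i hi => he (i + 1) (by simpa using hi))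
    rw [Nat.testBit_and, hm, Bool.true_and]
    exact opt_orE h1 y ((h2 y).2 ⟨hy, he 0 (by simp)⟩)

theorem path_exists {n : ℕ} : ∀ {cols : List KCol} {W : ℕ → ℕ → C × Bool}
    {Rs : List (List (C × Bool))}, CsInv n W cols Rs → ∀ p, ∃ x : ℕ → C → Bool,
    ∀ a : ℕ → C × Bool, (∀ i < cols.length, (a i).2 = x i (a i).1) →
    ∃ ls, ls.length = cols.length ∧ PathOK n W a (kMkLv cols p) ls ∧
      ∀ W' : ℕ → ℕ → C × Bool, (∀ y < n, W' y = W y) → W' n = a →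
      ∃ Rs', CsInv (n + 1) W' (kAddW cols ls (2 ^ n)) Rs'
  | [], W, [], _, p => ⟨fun _ _ => false, fun a _ => ⟨[], rfl, trivial,
      fun W' _ _ => ⟨[], trivial⟩⟩⟩
  | c :: t, W, R :: Rs, hc, p => by
    obtain ⟨x, hx⟩ := path_exists hc.2 (kShc c p)
    obtain ⟨x0, hx0⟩ := opts_spec hc.1.1 hc.1.2.1 p 0
    refine ⟨fun i => match i with | 0 => x0 | i + 1 => x i, fun a ha => ?_⟩
    obtain ⟨ls, hlen, hpath, hadd⟩ := hx (fun i => a (i + 1))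
      (fun i hi => ha (i + 1) (by simpa using hi))
    obtain ⟨l, e, f, hm, h⟩ := hx0 (a 0) (ha 0 (by simp))
    rw [Nat.zero_add] at hm
    refine ⟨l :: ls, by simp [hlen], ⟨⟨e, f, hm, ?_⟩, ?_, ?_, hpath⟩, ?_⟩
    · rcases h with h | ⟨h1, h2, h3, h4⟩
      · exact h.2
      · subst h3; subst h4
        constructor
        · intro y
          simp only [Nat.zero_testBit, Bool.false_eq_true, false_iff, not_and]
          intro hy e
          exact h1 (by rw [← e]; exact hc.1.2.2 y hy)
        · intro y
          simp only [Nat.zero_testBit, Bool.false_eq_true, false_iff, not_and]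
          intro hy e
          apply h1
          have := hc.1.2.2 y hy
          simp only [e] at this
          exact this
    · exact fun y hy => kTop_lt hc.2 _ _ hy
    · exact fun y hy he => path_top hpath y hy he
    · intro W' hW hWn
      obtain ⟨Rs', hRs⟩ := hadd (fun x i => W' x (i + 1)) (fun y hy => by rw [hW y hy])
        (by rw [hWn])
      have h0 : ∀ x < n, (fun x => W' x 0) x = (fun x => W x 0) x := by
        intro x hx'
        show W' x 0 = W x 0
        rw [hW x hx']
      rcases h with h | ⟨h1, h2, h3, h4⟩
      · exact ⟨R :: Rs', ci_add h0 hc.1 (by show LkR R l (W' n 0); rw [hWn]; exact h.1), hRs⟩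
      · exact ⟨(R ++ [W' n 0]) :: Rs', ci_fresh h0 hc.1 (by show (W' n 0).1 ∉ _; rw [hWn]; exact h1) h2, hRs⟩
  | [], W, _ :: _, hc, p => hc.elim
  | _ :: _, W, [], hc, p => hc.elim

theorem mem_kApp {a b : List KSt} {S : KSt} : S ∈ kApp a b ↔ S ∈ a ∨ S ∈ b := by
  induction a with
  | nil => simp [kApp]
  | cons x a ih =>
    show S ∈ x :: kApp a b ↔ _
    rw [List.mem_cons, ih, List.mem_cons, or_assoc]

theorem kDfs_cons (full : ℕ) (o : KOpt) (suf : ℕ) (t : KLv) (m E Tw : ℕ) (k : List ℕ → KSt)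
    {l e f : ℕ} (ho : OptMem l e f o) (hf : (m ||| f) ||| suf = full) (S : KSt)
    (hS : S ∈ kDfs full t (m ||| f) (E &&& e) ((Tw &&& e) ||| (E &&& f)) (fun w => k (l :: w))) :
    S ∈ kDfs full (.cons o suf t) m E Tw k := by
  induction o with
  | nil => exact ho.elim
  | cons l' e' f' o' ih =>
    have h : kDfs full (.cons (.cons l' e' f' o') suf t) m E Tw k =
      Bool.rec (motive := fun _ => List KSt) (kDfs full (.cons o' suf t) m E Tw k)
        (kApp (kDfs full t (m ||| f') (E &&& e') ((Tw &&& e') ||| (E &&& f'))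
          (fun w => k (l' :: w))) (kDfs full (.cons o' suf t) m E Tw k))
        (Nat.beq ((m ||| f') ||| suf) full) := rfl
    rw [h]
    rcases ho with ⟨rfl, rfl, rfl⟩ | ho
    · have : Nat.beq ((m ||| f) ||| suf) full = true := by rw [hf]; exact Nat.beq_refl _
      rw [this]
      exact mem_kApp.2 (Or.inl hS)
    · cases Nat.beq ((m ||| f') ||| suf) full
      · exact ih ho
      · exact mem_kApp.2 (Or.inr (ih ho))

theorem dfs_sound {n : ℕ} : ∀ {v : KLv} {W : ℕ → ℕ → C × Bool} {a : ℕ → C × Bool}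
    {ls : List ℕ} {m E Tw : ℕ} {k : List ℕ → KSt}, PathOK n W a v ls →
    (∀ y, m.testBit y = true → y < n) →
    (∀ y < n, m.testBit y = true ∨ ∃ i < ls.length, W y i = kNeg (a i)) →
    (∀ y < n, Tw.testBit y = true → (∀ i < ls.length, W y i = a i) → False) →
    (∀ y < n, E.testBit y = true → ∀ j < ls.length, W y j = kNeg (a j) →
      (∀ i < ls.length, i ≠ j → W y i = a i) → False) →
    (∀ y, Tw.testBit y = true → y < n) →
    k ls ∈ kDfs (2 ^ n - 1) v m E Tw k
  | .nil, W, a, [], m, E, Tw, k, _, _, _, hT, _, hTn => by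
    have : Tw = 0 := by
      apply Nat.eq_of_testBit_eq
      intro y
      rw [Nat.zero_testBit]
      by_contra h
      have h : Tw.testBit y = true := by simpa using h
      exact hT y (hTn y h) h (by simp)
    subst this
    show k [] ∈ [k []]
    simp
  | .cons o s t, W, a, l :: ls, m, E, Tw, k, h, hm, hm2, hT, hE, hTn => by
    obtain ⟨⟨e, f, h1, h2, h3⟩, h4, h5, h6⟩ := h
    have hm' : ∀ y, (m ||| f).testBit y = true → y < n := by
      intro y hy
      rw [Nat.testBit_or, Bool.or_eq_true] at hy
      rcases hy with hy | hy
      · exact hm y hy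
      · exact ((h3 y).1 hy).1
    have hm2' : ∀ y < n, (m ||| f).testBit y = true ∨
        ∃ i < ls.length, W y (i + 1) = kNeg (a (i + 1)) := by
      intro y hy
      rw [Nat.testBit_or, Bool.or_eq_true]
      rcases hm2 y hy with h | ⟨i, hi, he⟩
      · exact Or.inl (Or.inl h)
      · cases i with
        | zero => exact Or.inl (Or.inr ((h3 y).2 ⟨hy, he⟩))
        | succ i => exact Or.inr ⟨i, by simpa using hi, he⟩
    refine kDfs_cons _ o s t m E Tw k h1 ?_ _ ?_
    · apply Nat.eq_of_testBit_eq
      intro y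
      rw [Nat.testBit_two_pow_sub_one]
      by_cases hy : y < n
      · simp only [hy, decide_true]
        rw [Nat.testBit_or, Bool.or_eq_true]
        rcases hm2' y hy with h | h
        · exact Or.inl h
        · exact Or.inr (h5 y hy h)
      · simp only [hy, decide_false]
        by_contra hb
        have hb : ((m ||| f) ||| s).testBit y = true := by
          rw [Bool.not_eq_false] at hb; exact hb
        rw [Nat.testBit_or, Bool.or_eq_true] at hb
        rcases hb with hb | hb
        · exact hy (hm' y hb)
        · exact hy (h4 y hb)
    · refine dfs_sound (k := fun w => k (l :: w)) h6 hm' hm2' ?_ ?_ ?_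
      · intro y hy hb he
        rw [Nat.testBit_or, Bool.or_eq_true, Nat.testBit_and, Nat.testBit_and, Bool.and_eq_true,
          Bool.and_eq_true] at hb
        rcases hb with ⟨b1, b2⟩ | ⟨b1, b2⟩
        · refine hT y hy b1 (fun i hi => ?_)
          cases i with
          | zero => exact ((h2 y).1 b2).2
          | succ i => exact he i (by simpa using hi)
        · refine hE y hy b1 0 (by simp) ((h3 y).1 b2).2 (fun i hi hi0 => ?_)
          cases i with
          | zero => exact absurd rfl hi0
          | succ i => exact he i (by simpa using hi)
      · intro y hy hb j hj hj1 hj2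
        rw [Nat.testBit_and, Bool.and_eq_true] at hb
        refine hE y hy hb.1 (j + 1) (by simpa using hj) hj1 (fun i hi hne => ?_)
        cases i with
        | zero => exact ((h2 y).1 hb.2).2
        | succ i => exact hj2 i (by simpa using hi) (fun h => hne (by rw [h]))
      · intro y hb
        rw [Nat.testBit_or, Bool.or_eq_true, Nat.testBit_and, Nat.testBit_and, Bool.and_eq_true,
          Bool.and_eq_true] at hb
        rcases hb with ⟨b1, b2⟩ | ⟨b1, b2⟩
        · exact hTn y b1
        · exact ((h3 y).1 b2).1

/-- the state is realized in `T` -/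
def StInv (d : ℕ) (T : Set (ℕ → C × Bool)) : KSt → Prop
  | .mk full cols => ∃ n W Rs, full = 2 ^ n - 1 ∧ cols.length = d ∧ (∀ x < n, W x ∈ T) ∧
      CsInv n W cols Rs

theorem kAddW_length : ∀ (cols : List KCol) (w : List ℕ) (b : ℕ),
    (kAddW cols w b).length = cols.length
  | [], _, _ => rfl
  | c :: t, [], _ => rfl
  | c :: t, l :: w, b => by
    show (kAddCol c l b :: kAddW t w b).length = _
    simp [kAddW_length t w b]

theorem point_sound {d : ℕ} {T : Set (ℕ → C × Bool)} (hT : KGood d T) {full : ℕ}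
    {cols : List KCol} (h : StInv d T (.mk full cols)) (p : ℕ)
    (hcov : kCov (kMkLv cols p) full = 0) :
    ∃ S ∈ kDfs full (kMkLv cols p) 0 full 0
      (fun w => .mk (Nat.succ (Nat.mul 2 full)) (kAddW cols w (Nat.succ full))), StInv d T S := by
  obtain ⟨n, W, Rs, rfl, hlen, hW, hinv⟩ := h
  obtain ⟨x, hx⟩ := path_exists hinv p
  obtain ⟨a, haT, ha⟩ := hT.cover x
  rw [hlen] at hx
  obtain ⟨ls, hls, hpath, hadd⟩ := hx a ha
  have hpos : 0 < 2 ^ n := by positivity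
  have hnew : ∀ y < n, ∃ i < d, W y i = kNeg (a i) := by
    intro y hy
    rcases hT.dich (W y) (hW y hy) a haT with h | h
    · exfalso
      have := path_cov (m := 2 ^ n - 1) hpath y hy
        (by rw [Nat.testBit_two_pow_sub_one]; simpa using hy)
        (fun i hi => h i (by omega))
      rw [hcov] at this
      simp at this
    · exact h
  refine ⟨_, dfs_sound hpath (by simp) (fun y hy => Or.inr ?_) (by simp) ?_ (by simp), ?_⟩
  · rw [hls]; exact hnew y hy
  · intro y hy _ j hj h1 h2
    rw [hls] at hj h2
    exact hT.notwin (W y) (hW y hy) a haT j hj h1 h2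
  · obtain ⟨Rs', hRs⟩ := hadd (fun y => if y = n then a else W y)
      (fun y hy => by simp [Nat.ne_of_lt hy]) (by simp)
    refine ⟨n + 1, fun y => if y = n then a else W y, Rs', ?_, ?_, ?_, ?_⟩
    · show Nat.succ (2 * (2 ^ n - 1)) = _
      rw [pow_succ]; omega
    · rw [kAddW_length]; exact hlen
    · intro y hy
      by_cases hyn : y = n
      · simp [hyn, haT]
      · simp only [hyn, if_false]; exact hW y (by omega)
    · have : Nat.succ (2 ^ n - 1) = 2 ^ n := by omega
      rw [this]; exact hRs

end KSem2

section KSem3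

variable {C : Type}

theorem kLk_sound {n : ℕ} {u : ℕ → C × Bool} : ∀ {c : KCol} {R : List (C × Bool)} {l : ℕ}
    {k : ℕ → ℕ → Bool}, kLk c l k = true → ColInv n u c R → ∃ p q r, k p q = true ∧ LkR R l r ∧
      (∀ x, p.testBit x = true ↔ x < n ∧ u x = r) ∧
      (∀ x, q.testBit x = true ↔ x < n ∧ u x = kNeg r)
  | .nil, [], l, k, h, _ => by
    have h : false = true := h
    simp at h
  | .cons p q t, r :: R, 0, k, h, hc => ⟨p, q, r, h, rfl, hc.1, hc.2.1⟩
  | .cons p q t, r :: R, 1, k, h, hc =>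
    ⟨q, p, kNeg r, h, rfl, hc.2.1, by rw [kNeg_neg]; exact hc.1⟩
  | .cons p q t, r :: R, l + 2, k, h, hc => kLk_sound (c := t) (R := R) (l := l) h hc.2.2
  | .nil, _ :: _, _, _, _, hc => hc.elim
  | .cons _ _ _, [], _, _, _, hc => hc.elim

theorem lkR_index : ∀ {R : List (C × Bool)} {l : ℕ} {a : C × Bool}, LkR R l a →
    (R.map Prod.fst)[l / 2]? = some a.1
  | r :: R, 0, a, h => by have h : a = r := h; simp [h]
  | r :: R, 1, a, h => by have h : a = kNeg r := h; simp [h, kNeg]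
  | r :: R, l + 2, a, h => by
    have := lkR_index (R := R) (l := l) (a := a) h
    rw [show (l + 2) / 2 = l / 2 + 1 by omega]
    simpa using this

theorem kTrC_sound {N : ℕ} {u : ℕ → C × Bool} {col : KCol} {R : List (C × Bool)}
    (hc : ColInv N u col R) (hd : KNd R) : ∀ (n code used : ℕ) (k : ℕ → KCol → Bool),
    kTrC col n code used k = true → ∃ R' col' code', k code' col' = true ∧
      ColInv N u col' R' ∧ KNd R' ∧ ∀ r ∈ R', ∃ c, used.testBit c = false ∧
        (R.map Prod.fst)[c]? = some r.1
  | 0, code, used, k, h => ⟨[], .nil, code, h, trivial, by simp [KNd], by simp⟩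
  | n + 1, code, used, k, h => by
    have h : Nat.rec (motive := fun _ => Bool)
        (kLk col (code % 16) (fun p q =>
          kTrC col n (code / 16) (used ||| (2 ^ (code % 16 / 2)))
            (fun code' t => k code' (.cons p q t))))
        (fun _ _ => false)
        (used &&& (2 ^ (code % 16 / 2))) = true := h
    generalize hz : used &&& (2 ^ (code % 16 / 2)) = z at h
    cases z with
    | succ z => simp at h
    | zero =>
      obtain ⟨p, q, r, hk, hl, hp, hq⟩ := kLk_sound h hc
      obtain ⟨R', col', code', h1, h2, h3, h4⟩ := kTrC_sound hc hd n _ _ _ hk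
      have hi := lkR_index hl
      refine ⟨r :: R', .cons p q col', code', h1, ⟨hp, hq, h2⟩, ?_, ?_⟩
      · simp only [KNd, List.map_cons, List.nodup_cons]
        refine ⟨?_, h3⟩
        intro hr
        rw [List.mem_map] at hr
        obtain ⟨r', hr', he⟩ := hr
        obtain ⟨c, hc1, hc2⟩ := h4 r' hr'
        rw [Nat.testBit_or, Bool.or_eq_false_iff, Nat.testBit_two_pow] at hc1
        rw [he, ← hi] at hc2
        have hlt : c < (R.map Prod.fst).length := by
          by_contra hcon
          rw [List.getElem?_eq_none (by omega), hi] at hc2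
          simp at hc2
        have := (List.getElem?_inj hlt hd).1 hc2
        simp [this] at hc1
      · intro r' hr'
        rcases List.mem_cons.1 hr' with rfl | hr'
        · refine ⟨_, ?_, hi⟩
          have := congrArg (fun m => Nat.testBit m (code % 16 / 2)) hz
          simpa [Nat.testBit_and, Nat.testBit_two_pow] using this
        · obtain ⟨c, hc1, hc2⟩ := h4 r' hr'
          rw [Nat.testBit_or, Bool.or_eq_false_iff] at hc1
          exact ⟨c, hc1.1, hc2⟩

theorem kGetCol_sound {n : ℕ} : ∀ {cols : List KCol} {W : ℕ → ℕ → C × Bool}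
    {Rs : List (List (C × Bool))}, CsInv n W cols Rs → ∀ i, ∃ R,
    ColInv n (fun x => W x i) (kGetCol cols i) R ∧ KNd R
  | [], W, [], _, i => ⟨[], trivial, by simp [KNd]⟩
  | c :: t, W, R :: Rs, h, 0 => ⟨R, h.1.1, h.1.2.1⟩
  | c :: t, W, R :: Rs, h, i + 1 => kGetCol_sound h.2 i
  | [], W, _ :: _, hc, _ => hc.elim
  | _ :: _, W, [], hc, _ => hc.elim

def PInv (n : ℕ) (W : ℕ → ℕ → C × Bool) : List ℕ → List KCol → List (List (C × Bool)) → Prop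
  | [], [], [] => True
  | i :: is, c :: cs, R :: Rs => ColInv n (fun x => W x i) c R ∧ KNd R ∧ PInv n W is cs Rs
  | _, _, _ => False

theorem kTr_sound {n : ℕ} {cols : List KCol} {W : ℕ → ℕ → C × Bool}
    {Rs : List (List (C × Bool))} (hc : CsInv n W cols Rs) (pfull : ℕ) :
    ∀ (K : List ℕ) (code pm : ℕ) (k : List KCol → Bool), kTr cols pfull K code pm k = true →
    ∃ is cs Rs', k cs = true ∧ PInv n W is cs Rs' ∧ is.length = K.length ∧
      ∀ i, pfull.testBit i = true → pm.testBit i = true ∨ i ∈ is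
  | [], code, pm, k, h => by
    have h : Bool.rec (motive := fun _ => Bool) false (k []) (Nat.beq pm pfull) = true := h
    cases hb : Nat.beq pm pfull with
    | false => rw [hb] at h; simp at h
    | true =>
      rw [hb] at h
      have := Nat.eq_of_beq_eq_true hb
      exact ⟨[], [], [], h, trivial, rfl, fun i hi => Or.inl (by rw [this]; exact hi)⟩
  | m :: K, code, pm, k, h => by
    obtain ⟨R, hR, hd⟩ := kGetCol_sound hc (code % 8)
    obtain ⟨R', c', code', h1, h2, h3, -⟩ := kTrC_sound hR hd m (code / 8) 0 _ h
    obtain ⟨is, cs, Rs', h4, h5, h6, h7⟩ := kTr_sound hc pfull K code'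
      (pm ||| 2 ^ (code % 8)) _ h1
    refine ⟨code % 8 :: is, c' :: cs, R' :: Rs', h4, ⟨h2, h3, h5⟩, by simp [h6], ?_⟩
    intro i hi
    rcases h7 i hi with h | h
    · rw [Nat.testBit_or, Bool.or_eq_true, Nat.testBit_two_pow, decide_eq_true_eq] at h
      rcases h with h | h
      · exact Or.inl h
      · right; rw [h]; simp
    · right; simp [h]

def RealW : List (List (C × Bool)) → ℕ → (ℕ → C × Bool) → Prop
  | [], _, _ => True
  | R :: Rs, w, a => LkR R (w % 16) (a 0) ∧ RealW Rs (w / 16) (fun i => a (i + 1))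

theorem kLkm_sound {n : ℕ} {u : ℕ → C × Bool} {y : ℕ} : ∀ {c : KCol} {R : List (C × Bool)}
    {l : ℕ}, (kLkm c l).testBit y = true → ColInv n u c R → LkR R l (u y)
  | .nil, [], l, h, _ => by
    have h : Nat.testBit 0 y = true := h
    simp at h
  | .cons p q t, r :: R, 0, h, hc => ((hc.1 y).1 h).2
  | .cons p q t, r :: R, 1, h, hc => ((hc.2.1 y).1 h).2
  | .cons p q t, r :: R, l + 2, h, hc => kLkm_sound (c := t) (R := R) (l := l) h hc.2.2
  | .nil, _ :: _, _, _, hc => hc.elim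
  | .cons _ _ _, [], _, _, hc => hc.elim

theorem kWord_sound {n : ℕ} {W : ℕ → ℕ → C × Bool} : ∀ {is : List ℕ} {cs : List KCol}
    {Rs : List (List (C × Bool))} {w m : ℕ}, PInv n W is cs Rs → kWord cs w m = true →
    ∃ y, m.testBit y = true ∧ RealW Rs w (fun i => W y (is.getD i 0))
  | [], [], [], w, m, _, h => by
    have h : Nat.rec (motive := fun _ => Bool) false (fun _ _ => true) m = true := h
    cases m with
    | zero => simp at h
    | succ m =>
      obtain ⟨y, hy⟩ := Nat.exists_testBit_of_ne_zero (Nat.succ_ne_zero m)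
      exact ⟨y, hy, trivial⟩
  | i :: is, c :: cs, R :: Rs, w, m, hp, h => by
    have h : kWord cs (w / 16) (m &&& kLkm c (w % 16)) = true := h
    obtain ⟨y, hy, hr⟩ := kWord_sound hp.2.2 h
    rw [Nat.testBit_and, Bool.and_eq_true] at hy
    exact ⟨y, hy.1, kLkm_sound (u := fun x => W x i) hy.2 hp.1, hr⟩
  | [], [], _ :: _, _, _, hp, _ => hp.elim
  | [], _ :: _, _, _, _, hp, _ => hp.elim
  | _ :: _, [], _, _, _, hp, _ => hp.elim
  | _ :: _, _ :: _, [], _, _, hp, _ => hp.elim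

theorem kWords_sound {cs : List KCol} {full : ℕ} : ∀ {ws : List ℕ}, kWords cs full ws = true →
    ∀ w ∈ ws, kWord cs w full = true
  | [], _, w, hw => by simp at hw
  | v :: ws, h, w, hw => by
    have h : Bool.rec (motive := fun _ => Bool) false (kWords cs full ws) (kWord cs v full) = true
      := h
    cases hb : kWord cs v full with
    | false => rw [hb] at h; simp at h
    | true =>
      rw [hb] at h
      rcases List.mem_cons.1 hw with rfl | hw
      · exact hb
      · exact kWords_sound h w hw

theorem pInv_nd {n : ℕ} {W : ℕ → ℕ → C × Bool} : ∀ {is : List ℕ} {cs : List KCol}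
    {Rs : List (List (C × Bool))}, PInv n W is cs Rs → Rs.length = is.length ∧ ∀ R ∈ Rs, KNd R
  | [], [], [], _ => by simp
  | i :: is, c :: cs, R :: Rs, hp => by
    have := pInv_nd hp.2.2
    refine ⟨by simp [this.1], ?_⟩
    intro R' hR'
    rcases List.mem_cons.1 hR' with rfl | h
    · exact hp.2.1
    · exact this.2 R' h
  | [], [], _ :: _, hp => hp.elim
  | [], _ :: _, _, hp => hp.elim
  | _ :: _, [], _, hp => hp.elim
  | _ :: _, _ :: _, [], hp => hp.elim

def KReal (d : ℕ) (T : Set (ℕ → C × Bool)) (ws : List ℕ) : Prop :=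
  ∃ Rs : List (List (C × Bool)), Rs.length = d ∧ (∀ R ∈ Rs, KNd R) ∧
    ∀ w ∈ ws, ∃ a ∈ T, RealW Rs w a

def KRefuted (C : Type) (d : ℕ) (ws : List ℕ) : Prop :=
  ∀ T : Set (ℕ → C × Bool), KGood d T → ¬ KReal d T ws

theorem kGood_perm {d : ℕ} {T : Set (ℕ → C × Bool)} (hT : KGood d T) (f g : ℕ → ℕ)
    (hf : ∀ i < d, f i < d) (hg : ∀ i < d, g i < d) (hfg : ∀ i < d, f (g i) = i)
    (hgf : ∀ i < d, g (f i) = i) :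
    KGood d ((fun v : ℕ → C × Bool => fun i => v (f i)) '' T) := by
  refine ⟨fun x => ?_, ?_, ?_⟩
  · obtain ⟨w, hw, h⟩ := hT.cover (fun j => x (g j))
    refine ⟨_, ⟨w, hw, rfl⟩, fun i hi => ?_⟩
    have := h (f i) (hf i hi)
    rw [hgf i hi] at this
    exact this
  · rintro _ ⟨v, hv, rfl⟩ _ ⟨w, hw, rfl⟩
    rcases hT.dich v hv w hw with h | ⟨i, hi, h⟩
    · exact Or.inl fun i hi => h _ (hf i hi)
    · refine Or.inr ⟨g i, hg i hi, ?_⟩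
      show v (f (g i)) = kNeg (w (f (g i)))
      rw [hfg i hi]; exact h
  · rintro _ ⟨v, hv, rfl⟩ _ ⟨w, hw, rfl⟩ j hj h1 h2
    refine hT.notwin v hv w hw (f j) (hf j hj) h1 (fun i hi hij => ?_)
    have := h2 (g i) (hg i hi) (fun e => hij (by rw [← e, hfg i hi]))
    simpa only [hfg i hi] using this

def kWs : KLem → List ℕ
  | .mk _ ws _ => ws

theorem list_perm_fun {d : ℕ} {is : List ℕ} (hl : is.length = d) (hs : ∀ i < d, i ∈ is) :
    ∃ g : ℕ → ℕ, (∀ i < d, is.getD i 0 < d) ∧ (∀ i < d, g i < d) ∧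
      (∀ i < d, is.getD (g i) 0 = i) ∧ (∀ i < d, g (is.getD i 0) = i) := by
  have hp : (List.range d).Perm is := by
    refine (List.subperm_of_subset List.nodup_range ?_).perm_of_length_le (by simp [hl])
    intro i hi
    exact hs i (List.mem_range.1 hi)
  have hn : is.Nodup := hp.nodup_iff.1 List.nodup_range
  refine ⟨fun i => is.idxOf i, ?_, ?_, ?_, ?_⟩
  · intro i hi
    have h : is.getD i 0 ∈ is := by
      rw [List.getD_eq_getElem _ _ (by omega)]
      exact List.getElem_mem _
    exact List.mem_range.1 (hp.mem_iff.2 h)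
  · intro i hi
    rw [← hl]; exact List.idxOf_lt_length_of_mem (hs i hi)
  · intro i hi
    have := List.idxOf_lt_length_of_mem (hs i hi)
    rw [List.getD_eq_getElem _ _ this]
    exact List.getElem_idxOf this
  · intro i hi
    rw [List.getD_eq_getElem _ _ (by omega)]
    exact hn.idxOf_getElem i (by omega)

theorem bool_rec_true {b c : Bool} (h : Bool.rec (motive := fun _ => Bool) false c b = true) :
    b = true ∧ c = true := by
  cases b
  · simp at h
  · exact ⟨rfl, h⟩

theorem list_len_rec (K : List ℕ) :
    List.rec (motive := fun _ => ℕ) 0 (fun _ _ ih => Nat.succ ih) K = K.length := by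
  induction K with
  | nil => rfl
  | cons a K ih => simp [ih]

theorem kRef_sound {d : ℕ} {tab : KTree} {j full : ℕ} {cols : List KCol} {o : ℕ}
    {T : Set (ℕ → C × Bool)} (hT : KGood d T) (h : kRef d tab j full cols o = true)
    (hS : StInv d T (.mk full cols)) (hr : ∀ i < j, KRefuted C d (kWs (kGet tab i))) : False := by
  obtain ⟨n, W, Rs, rfl, hlen, hW, hinv⟩ := hS
  obtain ⟨hlt, h⟩ := bool_rec_true h
  have hlt : o % 256 < j := Nat.le_of_ble_eq_true hlt
  specialize hr _ hlt
  have e : Nat.mod o 256 = o % 256 := rfl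
  rw [e] at h
  cases hg : kGet tab (o % 256) with
  | mk K ws ops =>
    rw [hg] at h hr
    obtain ⟨hK, h⟩ := bool_rec_true h
    have hK := Nat.eq_of_beq_eq_true hK
    rw [list_len_rec] at hK
    obtain ⟨is, cs, Rs', h1, h2, h3, h4⟩ := kTr_sound hinv _ K _ 0 _ h
    have hs : ∀ i < d, i ∈ is := by
      intro i hi
      have h5 : (2 ^ d - 1).testBit i = true := by
        rw [Nat.testBit_two_pow_sub_one]; simpa using hi
      rcases h4 i h5 with h6 | h6
      · simp at h6
      · exact h6
    obtain ⟨g, g1, g2, g3, g4⟩ := list_perm_fun (h3.trans hK) hs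
    refine hr _ (kGood_perm hT (fun i => is.getD i 0) g g1 g2 g3 g4) ?_
    obtain ⟨p1, p2⟩ := pInv_nd h2
    refine ⟨Rs', by omega, p2, fun w hw => ?_⟩
    obtain ⟨y, hy, hrw⟩ := kWord_sound h2 (kWords_sound h1 w hw)
    rw [Nat.testBit_two_pow_sub_one] at hy
    exact ⟨_, ⟨W y, hW y (by simpa using hy), rfl⟩, hrw⟩

theorem kLoop_sound {d : ℕ} {tab : KTree} {j : ℕ} {T : Set (ℕ → C × Bool)} (hT : KGood d T)
    (hr : ∀ i < j, KRefuted C d (kWs (kGet tab i))) : ∀ (ops : List ℕ) (st : List KSt),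
    kLoop d tab j ops st = true → ∀ S ∈ st, ¬ StInv d T S
  | [], [], _, S, hS => by simp at hS
  | [], x :: st, h, S, hS => by
    have h : false = true := h
    simp at h
  | o :: ops, [], h, S, hS => by simp at hS
  | o :: ops, .mk full cols :: rest, h, S, hS => by
    have h : Nat.rec (motive := fun _ => Bool)
          (Nat.rec (motive := fun _ => Bool)
            (kLoop d tab j ops (kApp (kDfs full (kMkLv cols (o / 2)) 0 full 0
              (fun w => .mk (Nat.succ (Nat.mul 2 full)) (kAddW cols w (Nat.succ full)))) rest))
            (fun _ _ => false)
            (kCov (kMkLv cols (o / 2)) full))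
          (fun _ _ => Bool.rec (motive := fun _ => Bool) false (kLoop d tab j ops rest)
            (kRef d tab j full cols (o / 2)))
          (o % 2) = true := h
    generalize o % 2 = z at h
    cases z with
    | zero =>
      generalize hcov : kCov (kMkLv cols (o / 2)) full = z at h
      cases z with
      | succ z => simp at h
      | zero =>
        have ih := kLoop_sound hT hr ops _ h
        rcases List.mem_cons.1 hS with rfl | hS
        · intro hst
          obtain ⟨S', h1, h2⟩ := point_sound hT hst _ hcov
          exact ih S' (mem_kApp.2 (Or.inl h1)) h2
        · exact ih S (mem_kApp.2 (Or.inr hS))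
    | succ z =>
      obtain ⟨h1, h2⟩ := bool_rec_true h
      rcases List.mem_cons.1 hS with rfl | hS
      · exact fun hst => kRef_sound hT h1 hst hr
      · exact kLoop_sound hT hr ops rest h2 S hS

theorem lk_prefix : ∀ {R0 R1 : List (C × Bool)} {l : ℕ} {a : C × Bool}, LkR (R0 ++ R1) l a →
    l ≤ 2 * R0.length → LkR R0 l a ∨ (l = 2 * R0.length ∧ ∃ R2, R1 = a :: R2)
  | [], [], l, a, h, _ => h.elim
  | [], r :: R1, l, a, h, hl => by
    have : l = 0 := by simpa using hl
    subst this
    have h : a = r := h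
    exact Or.inr ⟨rfl, R1, by rw [h]⟩
  | r :: R0, R1, 0, a, h, _ => Or.inl h
  | r :: R0, R1, 1, a, h, _ => Or.inl h
  | r :: R0, R1, l + 2, a, h, hl => by
    have h : LkR (R0 ++ R1) l a := h
    rcases lk_prefix h (by simp at hl; omega) with h | ⟨h, h'⟩
    · exact Or.inl h
    · exact Or.inr ⟨by simp; omega, h'⟩

theorem build_step {n : ℕ} : ∀ {cols : List KCol} {W : ℕ → ℕ → C × Bool}
    {R0s Rs : List (List (C × Bool))} {w : ℕ} {a : ℕ → C × Bool}, CsInv n W cols R0s →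
    List.Forall₂ (fun R0 R => R0 <+: R) R0s Rs → (∀ R ∈ Rs, KNd R) → kOkW cols w = true →
    RealW Rs w a → ∀ W' : ℕ → ℕ → C × Bool, (∀ y < n, W' y = W y) → W' n = a →
    ∃ R0s', CsInv (n + 1) W' (kAddW cols (kDig cols.length w) (2 ^ n)) R0s' ∧
      List.Forall₂ (fun R0 R => R0 <+: R) R0s' Rs
  | [], W, [], Rs, w, a, _, hf, _, _, _, W', _, _ => ⟨[], trivial, hf⟩
  | c :: t, W, R0 :: R0s, Rs, w, a, hc, hf, hd, hok, hrw, W', hW, hWn => by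
    cases hf with
    | @cons _ R _ Rs hp hf =>
      obtain ⟨R1, rfl⟩ := hp
      obtain ⟨h1, h2⟩ := bool_rec_true hok
      have h1 : w % 16 ≤ 2 * kLen c := Nat.le_of_ble_eq_true h1
      rw [colInv_len hc.1.1] at h1
      obtain ⟨R0s', q1, q2⟩ := build_step hc.2 hf (fun R hR => hd R (by simp [hR])) h2 hrw.2
        (fun x i => W' x (i + 1)) (fun y hy => by rw [hW y hy]) (by rw [hWn])
      have h0 : ∀ x < n, (fun x => W' x 0) x = (fun x => W x 0) x := by
        intro x hx'
        show W' x 0 = W x 0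
        rw [hW x hx']
      rcases lk_prefix hrw.1 h1 with h | ⟨h, R2, rfl⟩
      · exact ⟨R0 :: R0s', ⟨ci_add h0 hc.1 (by show LkR R0 _ (W' n 0); rw [hWn]; exact h), q1⟩,
          .cons ⟨R1, rfl⟩ q2⟩
      · refine ⟨(R0 ++ [W' n 0]) :: R0s', ⟨ci_fresh h0 hc.1 ?_ h, q1⟩, .cons ⟨R2, ?_⟩ q2⟩
        · show (W' n 0).1 ∉ _
          rw [hWn]
          have := hd (R0 ++ a 0 :: R2) (by simp)
          simp only [KNd, List.map_append, List.map_cons] at this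
          intro hm
          exact (List.nodup_append.1 this).2.2 _ hm _ (by simp) rfl
        · rw [hWn]; simp
  | [], W, _ :: _, Rs, w, a, hc, _, _, _, _, _, _, _ => hc.elim
  | _ :: _, W, [], Rs, w, a, hc, _, _, _, _, _, _, _ => hc.elim

theorem kBuild_sound {d : ℕ} {T : Set (ℕ → C × Bool)} {Rs : List (List (C × Bool))}
    (hd : ∀ R ∈ Rs, KNd R) (k : ℕ → List KCol → Bool) : ∀ (ws : List ℕ) (n : ℕ)
    (W : ℕ → ℕ → C × Bool) (cols : List KCol) (R0s : List (List (C × Bool))),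
    (∀ w ∈ ws, ∃ a ∈ T, RealW Rs w a) → cols.length = d → (∀ x < n, W x ∈ T) →
    CsInv n W cols R0s → List.Forall₂ (fun R0 R => R0 <+: R) R0s Rs →
    kBuild d k ws (2 ^ n - 1) cols = true →
    ∃ full' cols', k full' cols' = true ∧ StInv d T (.mk full' cols')
  | [], n, W, cols, R0s, _, hl, hW, hc, _, h => ⟨_, _, h, n, W, R0s, rfl, hl, hW, hc⟩
  | w :: ws, n, W, cols, R0s, hw, hl, hW, hc, hf, h => by
    obtain ⟨hok, h⟩ := bool_rec_true h
    obtain ⟨a, ha, har⟩ := hw w (by simp)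
    obtain ⟨R0s', h1, h2⟩ := build_step hc hf hd hok har (fun y => if y = n then a else W y)
      (fun y hy => by simp [Nat.ne_of_lt hy]) (by simp)
    have hpos : 0 < 2 ^ n := by positivity
    have e1 : Nat.succ (2 ^ n - 1) = 2 ^ n := by omega
    have e2 : Nat.succ (Nat.mul 2 (2 ^ n - 1)) = 2 ^ (n + 1) - 1 := by
      show Nat.succ (2 * (2 ^ n - 1)) = _
      rw [pow_succ]; omega
    rw [e1, e2] at h
    rw [hl] at h1
    refine kBuild_sound hd k ws (n + 1) _ _ R0s' (fun w hw' => hw w (by simp [hw']))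
      ((kAddW_length _ _ _).trans hl) ?_ h1 h2 h
    intro y hy
    by_cases hyn : y = n
    · simp [hyn, ha]
    · simp only [hyn, if_false]; exact hW y (by omega)

theorem kNils_length : ∀ d, (kNils d).length = d
  | 0 => rfl
  | d + 1 => by
    show (KCol.nil :: kNils d).length = _
    simp [kNils_length d]

theorem kNils_inv : ∀ (d : ℕ) (W : ℕ → ℕ → C × Bool) (Rs : List (List (C × Bool))),
    Rs.length = d → ∃ R0s, CsInv 0 W (kNils d) R0s ∧
      List.Forall₂ (fun R0 R => R0 <+: R) R0s Rs
  | 0, W, [], _ => ⟨[], trivial, .nil⟩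
  | d + 1, W, R :: Rs, h => by
    obtain ⟨R0s, h1, h2⟩ := kNils_inv d (fun x i => W x (i + 1)) Rs (by simpa using h)
    exact ⟨[] :: R0s, ⟨⟨trivial, by simp [KNd], by simp⟩, h1⟩, .cons (List.nil_prefix) h2⟩
  | 0, W, _ :: _, h => by simp at h
  | d + 1, W, [], h => by simp at h

theorem kChk1_sound {d : ℕ} {tab : KTree} {j : ℕ} (h : kChk1 d tab j = true)
    (hr : ∀ i < j, KRefuted C d (kWs (kGet tab i))) : KRefuted C d (kWs (kGet tab j)) := by
  intro T hT hreal
  unfold kChk1 at h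
  cases hg : kGet tab j with
  | mk K ws ops =>
    rw [hg] at h hreal
    obtain ⟨Rs, hl, hd, hws⟩ := hreal
    obtain ⟨a, -, -⟩ := hT.cover (fun _ _ => false)
    obtain ⟨R0s, h1, h2⟩ := kNils_inv d (fun _ => a) Rs hl
    obtain ⟨full, cols, h3, h4⟩ := kBuild_sound hd _ ws 0 (fun _ => a) (kNils d) R0s hws
      (kNils_length d) (by simp) h1 h2 h
    exact kLoop_sound hT hr ops _ h3 _ (by simp) h4

theorem kChk_sound {d : ℕ} {tab : KTree} {lo : ℕ} : ∀ {n : ℕ}, kChk d tab lo n = true →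
    ∀ j, lo ≤ j → j < lo + n → kChk1 d tab j = true
  | 0, _, j, h1, h2 => by omega
  | n + 1, h, j, h1, h2 => by
    obtain ⟨h3, h4⟩ := bool_rec_true h
    by_cases hj : j = lo + n
    · subst hj; exact h3
    · exact kChk_sound h4 j h1 (by omega)

theorem kAll_refuted {d : ℕ} {tab : KTree} {N : ℕ} (h : ∀ j < N, kChk1 d tab j = true) :
    ∀ j < N, KRefuted C d (kWs (kGet tab j)) := by
  intro j
  induction j using Nat.strong_induction_on with
  | _ j ih =>
    intro hj
    exact kChk1_sound (h j hj) (fun i hi => ih i hi (by omega))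

theorem realW_zero : ∀ (d : ℕ) (a : ℕ → C × Bool), ∃ Rs : List (List (C × Bool)),
    Rs.length = d ∧ (∀ R ∈ Rs, KNd R) ∧ RealW Rs 0 a
  | 0, a => ⟨[], rfl, by simp, trivial⟩
  | d + 1, a => by
    obtain ⟨Rs, h1, h2, h3⟩ := realW_zero d (fun i => a (i + 1))
    refine ⟨[a 0] :: Rs, by simp [h1], ?_, rfl, h3⟩
    intro R hR
    rcases List.mem_cons.1 hR with rfl | h
    · simp [KNd]
    · exact h2 R h

theorem kMain {d : ℕ} (tab : KTree) (j : ℕ) (h : ∀ i < j + 1, kChk1 d tab i = true)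
    (hroot : kWs (kGet tab j) = [0]) {T : Set (Fin d → ℝ)} (hT : IsCubeTiling d T) :
    HasTwinPair d T := by
  by_contra hno
  obtain ⟨T', hT'⟩ := kel_good hT hno
  obtain ⟨a, ha, -⟩ := hT'.cover (fun _ _ => false)
  have := kAll_refuted (C := ℝ) h j (by omega) T' hT'
  rw [hroot] at this
  obtain ⟨Rs, h1, h2, h3⟩ := realW_zero d a
  exact this ⟨Rs, h1, h2, fun w hw => ⟨a, ha, by rw [List.mem_singleton.1 hw]; exact h3⟩⟩

end KSem3

def kL1_0 : KLem := .mk [1] [0] [2]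
def kTab1 : KTree := .leaf kL1_0
def kL2_0 : KLem := .mk [1,1] [0] [2,14]
def kTab2 : KTree := .leaf kL2_0
def kL3_0 : KLem := .mk [1,1,1] [0] [8,24,34,54,2,22,8,28,18,58]
def kTab3 : KTree := .leaf kL3_0
def kL4_0 : KLem := .mk [1,1,2,1] [0,4608] [8,28,118,20,60,48,100,106]
def kL4_1 : KLem := .mk [1,2,2,1] [0,4640] [16,36515807233,38663290881,36507419137,8,19327550465,21475034113,8,19327550465,21475034113]
def kL4_2 : KLem := .mk [1,1,1,1] [0] [16,53703933953,53695610881,859278737411,53687222785,859278672387,859144455171,32,36515807233,38663290881,36507419137,190204420097,618626287107,38654902785,584283325955,618643064323]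
def kTab4 : KTree := .node (.node (.leaf kL4_0) (.leaf kL4_2)) (.leaf kL4_1)
def kL5_0 : KLem := .mk [1,1,2,2,1] [0,73728,78336] [208,428,860,486,1020,848,966,1960]
def kL5_1 : KLem := .mk [1,2,2,2,1] [0,73728,78368] [416,145190312542209,892,642408996681217,912,921408058963457,1582,836,637716887516673,637721182483969,1552,921957814777345,3118]
def kL5_2 : KLem := .mk [2,2,2,2,1] [0,73728,78370] [960,145190312542209,2323045016469507,2323045033246723,2323045016404483,1552,919758791521793,919763086489089,2323045033181699,1540,919741620041217,919745915008513,3104,2323027844988931,921960096478721,6256]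
def kL5_3 : KLem := .mk [1,1,1,2,1] [0,73728] [96,145189238800385,145189230477313,2323027836600323,145189222089217,2323027836535299,2323027702318083,37168445385736197]
def kL5_4 : KLem := .mk [1,2,2,2,1] [0,74240,4640] [16,389536496746497,4948909817863,4672958169607,36,76967970080257,35752415269895,608,81383188071937,73134736872455]
def kL5_5 : KLem := .mk [1,2,3,2,1] [0,74240,5152] [192,116584748417025,75334834388999,6201797634951177,75041702879751,880,1207557972825601,73134737413127]
def kL5_6 : KLem := .mk [2,2,2,2,1] [0,74240,4130] [400,112169513649153,2323027844988937,6197124593223689,37660455018503,37935332925447,37950365303815,99155060268861451,99155060285638667]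
def kL5_7 : KLem := .mk [2,2,2,2,1] [0,74240,4642] [152,1794712499390467,37400609498119,37169025230372875,37402756980743,37952512794631,99189697032620043,37950365312007,928,74801184715271,609443108886017,75625818436103]
def kL5_8 : KLem := .mk [2,2,3,2,1] [0,74240,5154] [384,1865355987257347,74784004841991,37169300116668427,74785078583303,75334834397191,37169300116603403,75333760655879,3104,37400609506311,1484910049367553,38225243227143]
def kL5_9 : KLem := .mk [1,1,2,2,1] [0,74240] [32,424738056896513,7149006684167,6873055100935,2323027836600329,37169025221984267,6871981359623,2323027836535305,37169025221919243,37168445385736205,37168445385736207,594704403551879185]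
def kL5_10 : KLem := .mk [2,2,3,2,1] [0,74272,78850] [1120,39600774119431,40150529933319,15314582202488835,39857398424071,173503489049106443,173502973534607371,40132276331015,642411144160787]
def kL5_11 : KLem := .mk [2,3,3,2,1] [0,74272,78914] [3328,108205693722492939,10876989795735555,74784073007623,244506138203133963,74802326609927,75077204516871,75626960330759,1196840016688659,244505551823771659,75333828821511,1210034156221971]
def kL5_12 : KLem := .mk [1,2,2,2,1] [0,74272] [384,2358212208689155,41799797309447,108205692648751115,41800870985735,42350626799623,108205692514598923,42349553123335,677612838715411,108205172943094287,668797275743251,594704403551879189,668814455611923,42056421614087,677610548634131,594704401405444117,677593368765459,9515270461375774743]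
def kL5_13 : KLem := .mk [1,1,1,1,1] [0] [32,9074208997383,9073143644167,145189238800403,9072069967879,145189230477331,145172050673683,2323027836600345,9070996226567,145189222089235,145172042285587,2323027836535321,145154862416915,2323027702318105,2322752824411673,128,6874128777223,7149006684167,6873055100935,37203625212125709,114385725161491,7147933007879,109989826134035,114387872645139,6871981359623,37203627359608845,114385716773395,37203629506043917,108732942566563845,595249829786951697,114368536904723,595249827640516625,27835641608086233111,7146859266567,109989817745939,114387864257043,109972637877267,595249825493033489,27835641608085185047,114370684388371,27835641573725447191,1830205991684121]
def kTab5 : KTree := .node (.node (.node (.node (.leaf kL5_0) (.leaf kL5_8)) (.node (.leaf kL5_4) (.leaf kL5_12))) (.node (.node (.leaf kL5_2) (.leaf kL5_10)) (.leaf kL5_6))) (.node (.node (.node (.leaf kL5_1) (.leaf kL5_9)) (.node (.leaf kL5_5) (.leaf kL5_13))) (.node (.node (.leaf kL5_3) (.leaf kL5_11)) (.leaf kL5_7)))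
def kL6_0 : KLem := .mk [1,1,2,1,2,2] [0,2101248,1179648,1245696] [912,1980,3932,1956,1628,1616,3684,7418]
def kL6_1 : KLem := .mk [2,2,2,2,2,2] [0,2101248,1179648,1245728,1245954,1245746,1245235,1245987,2163474,1057554,3220242,3355410,2110226,8208] [6472,6696,2158,4040,3826,8160,1171809362185363457,5270,13338,86439704481370625,14056,86439709932855297,26010,86439704564146177,86439708859113473,13978,86439709850079745,26014,86439708776337921,17680,20154,86439709932855297,52540]
def kL6_2 : KLem := .mk [2,2,2,2,2,2] [0,2101248,1179648,1245728,1245954,1245746,1245235,1245987,2163474,1057554,3220242,3355410,2110226] [4296,4816943214692792401923,1783771025643278849,10408,1789393670409228801,4410,1783771025726054401,1783771030021021697,8344,1789371680260559361,4440,1783771029938246145,4368,21150,1789393674704196097,41000]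
def kL6_3 : KLem := .mk [2,2,2,2,2,2] [0,2101248,1179648,1245728,1245954,1245746,1245235,1245987,2163474,1057554,3220242,3355410] [1400,4816943214692792401925]
def kL6_4 : KLem := .mk [2,2,2,2,2,2] [0,2101248,1179648,1245728,1245954,1245746,1245235,1245987,2163474,1057554,3220242] [5960,4816943214692792401927,1384,10568]
def kL6_5 : KLem := .mk [2,2,2,2,2,2] [0,2101248,1179648,1245728,1245954,1245746,1245235,1245987,2163474,1057554] [5704,4816943214692792401929,13946]
def kL6_6 : KLem := .mk [2,2,2,1,2,2] [0,2101248,1179648,1245728,1245954,1245746,1245235,1245987,2163474] [1096,1733947878122135553,6520,15208,4816943214692792401931,3416,4816943777642745823243,14808,12360,5448,25416]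
def kL6_7 : KLem := .mk [2,2,2,2,2,3] [0,2101248,1179648,1245728,1245954,1245746,1245235,1245987,4260626,5317394,5452562,4207378,1057554,5386256,5386528] [11184,11234,13138,9984,15748,1984,21158,30312]
def kL6_8 : KLem := .mk [2,3,2,2,2,3] [0,2101248,1179648,1245728,1245954,1245746,1245235,1245987,4260626,5317394,5452562,4207378,1057554,5386256,5386560,5386578] [21194,22194,8608,27812,5764,58634]
def kL6_9 : KLem := .mk [2,3,2,2,2,3] [0,2101248,1179648,1245728,1245954,1245746,1245235,1245987,4260626,5317394,5452562,4207378,1057554,5386256,5386560] [21088,2494922730664347573551121,42462]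
def kL6_10 : KLem := .mk [2,2,2,2,2,3] [0,2101248,1179648,1245728,1245954,1245746,1245235,1245987,4260626,5317394,5452562,4207378,1057554,5386256] [15272,155932670666521439240207,2494922730664347573551123,86439980515794945,14832,10610,15174,9984,15808,18388,30422,30330,17128,2494922730664349721034769,58616,30646,155932670666792156464143,2494922730668677034869779,25362,28936,1920,5384,2494922730668677034869779,59088,2494922730664349721034771,36536,100730]
def kL6_11 : KLem := .mk [3,2,2,2,2,3] [0,2101248,1179648,1245728,1245954,1245746,1245235,1245987,4260626,5317394,5452562,4207378,1057554,5386260] [30288,17944,25496,58654,86439980515794945,29368,42522,21180,86439984727986689,59364,44344,86439984727986689,117598,42104,33912,121064]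
def kL6_12 : KLem := .mk [2,2,2,2,2,3] [0,2101248,1179648,1245728,1245954,1245746,1245235,1245987,4260626,5317394,5452562,4207378,1057554] [15176,155932670666521439240213,86439979359277569,29320,86439984810762241,42430,86439979442053121,86439983737020417,2494922730664343030071319,86439983654244865,36624,2494922730668674505704471,86439984810762241,121144]
def kL6_13 : KLem := .mk [2,2,2,2,2,3] [0,2101248,1179648,1245728,1245954,1245746,1245235,1245987,4260626,5317394,5452562,4207378] [6216,155932670666521439240217,11368,29898]
def kL6_14 : KLem := .mk [2,2,2,2,2,3] [0,2101248,1179648,1245728,1245954,1245746,1245235,1245987,4260626,5317394,5452562] [1352,155932670666521439240219,7114]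
def kL6_15 : KLem := .mk [2,2,2,2,2,3] [0,2101248,1179648,1245728,1245954,1245746,1245235,1245987,4260626,5317394] [16200,155932670666521439240221,19784]
def kL6_16 : KLem := .mk [2,2,2,1,2,3] [0,2101248,1179648,1245728,1245954,1245746,1245235,1245987,4260626] [8024,1735322266708942849,15688,31192,155932670666521439240223,72,14152,155932671229471392661531,27002,4952,19528,17898,61274]
def kL6_17 : KLem := .mk [2,3,2,2,3,2] [0,2101248,1179648,1245728,1245954,1245746,1245235,1245987,2360082,1385234,2437906,3355410,3416850,335888,336192,336210] [21714,22962,7312,31536,62260,15106]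
def kL6_18 : KLem := .mk [2,3,2,2,3,2] [0,2101248,1179648,1245728,1245954,1245746,1245235,1245987,2360082,1385234,2437906,3355410,3416850,335888,336192] [6256,1233755731832972948668451,10716]
def kL6_19 : KLem := .mk [2,2,2,2,3,2] [0,2101248,1179648,1245728,1245954,1245746,1245235,1245987,2360082,1385234,2437906,3355410,3416850,335888] [2088,2224,11490,3666,2624,8324,20228,6606,7658,1233755731832972948668453,1211807275898638849,2224,3190,10882,2560,10452,31424,21654,23790,6496,1233755731832975096152099,45786,6166,20786,1233755731837302409987109,6232,23776,43998,12480,1233755731832975096152101,12716,22380]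
def kL6_20 : KLem := .mk [2,2,2,2,3,2] [0,2101248,1179648,1245728,1245954,1245746,1245235,1245987,2360082,1385234,2437906,3355410,3416850] [2760,77109733239560525185063,121925600454251009,6312,1212933175805481473,43422,121925600537026561,121925604831993857,6298,1212911185656812033,45882,121925604749218305,45840,45146,1212933180100448769,24830]
def kL6_21 : KLem := .mk [2,2,2,2,3,2] [0,2101248,1179648,1245728,1245954,1245746,1245235,1245987,2360082,1385234,2437906,3355410] [13016,77109733239560525185065]
def kL6_22 : KLem := .mk [2,2,2,2,3,2] [0,2101248,1179648,1245728,1245954,1245746,1245235,1245987,2360082,1385234,2437906] [16200,14682,77109733239560525185067,25816,23000]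
def kL6_23 : KLem := .mk [2,2,2,2,3,2] [0,2101248,1179648,1245728,1245954,1245746,1245235,1245987,2360082,1385234] [6472,77109733239560525185069,20312]
def kL6_24 : KLem := .mk [2,2,2,1,3,2] [0,2101248,1179648,1245728,1245954,1245746,1245235,1245987,2360082] [3432,1735355253005688833,15178,8680,77109733239560525185071,6504,77109733802510478606381,31576,27752,14680,62040]
def kL6_25 : KLem := .mk [2,2,2,2,3,3] [0,2101248,1179648,1245728,1245954,1245746,1245235,1245987,4457234,5448466,4530962,1389330,5518098,4460560,4460832] [1464,9194,5586,29120,29904,23248,54992,422,28536]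
def kL6_26 : KLem := .mk [2,3,2,2,3,3] [0,2101248,1179648,1245728,1245954,1245746,1245235,1245987,4457234,5448466,4530962,1389330,5518098,4460560,4460864,4460882] [3022,11682,11680,61872,24964,31652,54970,50114]
def kL6_27 : KLem := .mk [2,3,2,2,3,3] [0,2101248,1179648,1245728,1245954,1245746,1245235,1245987,4457234,5448466,4530962,1389330,5518098,4460560,4460864] [16864,39919381959501106539266101,33752]
def kL6_28 : KLem := .mk [2,2,2,2,3,3] [0,2101248,1179648,1245728,1245954,1245746,1245235,1245987,4457234,5448466,4530962,1389330,5518098,4460560] [5288,2494961372468818874597427,39919381959501106539266103,1166771571682251265,13040,13554,5258,8384,22484,7888,29888,9038,25042,27626,1008,39919381959501108686749749,7132,25394,2494961372469089591821363,39919381959505436000584759,2392,3570,17096,50112,39919381959501108686749751,21418,42264]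
def kL6_29 : KLem := .mk [2,2,2,2,3,3] [0,2101248,1179648,1245728,1245954,1245746,1245235,1245987,4457234,5448466,4530962,1389330,5518098] [6088,2494961372468818874597433,1927583057747513857,19848,1167897471589093889,8186,1927583057830289409,1927583062125256705,17304,1167875481440424449,35772,1927583062042481153,17200,22046,1167897475884061185,102268]
def kL6_30 : KLem := .mk [2,2,2,2,3,3] [0,2101248,1179648,1245728,1245954,1245746,1245235,1245987,4457234,5448466,4530962,1389330] [29000,2494961372468818874597435]
def kL6_31 : KLem := .mk [2,2,2,2,3,3] [0,2101248,1179648,1245728,1245954,1245746,1245235,1245987,4457234,5448466,4530962] [7496,2494961372468818874597437,11114,56264]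
def kL6_32 : KLem := .mk [2,2,2,2,3,3] [0,2101248,1179648,1245728,1245954,1245746,1245235,1245987,4457234,5448466] [15432,2494961372468818874597439,29672]
def kL6_33 : KLem := .mk [2,2,2,1,3,3] [0,2101248,1179648,1245728,1245954,1245746,1245235,1245987,4457234] [9032,12106975100612849565729,1735322269930168321,23912,46570,28744,20424,35674,2494961372468818874597441,17864,29528,2494961373031768828018753,55656,14952,54856,31688,122218,8138]
def kL6_34 : KLem := .mk [2,2,2,2,2,2] [0,2101248,1179648,1245728,1245954,1245746,1245235,1245987,1123090,2097938,3154706,3355410,2175762] [3272,707106991794426369,7048,1167897213888893441,826,707106991877201921,707106996172169217,6552,1167875223740224001,8984,707106996089393665,13072,5816,1167897218183860737,3962]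
def kL6_35 : KLem := .mk [2,2,2,2,2,2] [0,2101248,1179648,1245728,1245954,1245746,1245235,1245987,1123090,2097938,3154706,3355410] [1002,4816943214692792401989]
def kL6_36 : KLem := .mk [2,2,2,2,2,2] [0,2101248,1179648,1245728,1245954,1245746,1245235,1245987,1123090,2097938,3154706] [5448,4816943214692792401991,11080]
def kL6_37 : KLem := .mk [2,2,2,2,2,2] [0,2101248,1179648,1245728,1245954,1245746,1245235,1245987,1123090,2097938] [5192,4816943214692792401993,13016]
def kL6_38 : KLem := .mk [2,2,2,2,2,3] [0,2101248,1179648,1245728,1245954,1245746,1245235,1245987,1123090,4195090,5251858,5452562,4272914,5386256,5386528] [10544,14818,14622,14784,9744,3924,18090,26618]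
def kL6_39 : KLem := .mk [2,3,2,2,2,3] [0,2101248,1179648,1245728,1245954,1245746,1245235,1245987,1123090,4195090,5251858,5452562,4272914,5386256,5386560,5386578] [22226,22318,11776,13200,63264,44734,61378]
def kL6_40 : KLem := .mk [2,3,2,2,2,3] [0,2101248,1179648,1245728,1245954,1245746,1245235,1245987,1123090,4195090,5251858,5452562,4272914,5386256,5386560] [21224,2494922730664347573551183,44494]
def kL6_41 : KLem := .mk [2,2,2,2,2,3] [0,2101248,1179648,1245728,1245954,1245746,1245235,1245987,1123090,4195090,5251858,5452562,4272914,5386256] [11176,155932670666521439240269,2494922730664347573551185,86422388329750529,9072,14714,15302,12480,3796,20244,29394,22138,26464,2494922730664349721034831,60904,22066,155932670666792156464205,2494922730668677034869841,21394,29440,20140,57216,2494922730668677034869841,42448,2494922730664349721034833,59068,89402]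
def kL6_42 : KLem := .mk [2,2,2,2,2,3] [0,2101248,1179648,1245728,1245954,1245746,1245235,1245987,1123090,4195090,5251858,5452562,4272914] [9032,155932670666521439240275,86422387173233153,18056,86422392624717825,36794,86422387256008705,86422391550976001,29338,86422392541942273,44828,86422391468200449,51088,34488,86422392624717825,84088]
def kL6_43 : KLem := .mk [2,2,2,2,2,3] [0,2101248,1179648,1245728,1245954,1245746,1245235,1245987,1123090,4195090,5251858,5452562] [4936,155932670666521439240277]
def kL6_44 : KLem := .mk [2,2,2,2,2,3] [0,2101248,1179648,1245728,1245954,1245746,1245235,1245987,1123090,4195090,5251858] [9544,155932670666521439240279,13144,27978]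
def kL6_45 : KLem := .mk [2,2,2,2,2,3] [0,2101248,1179648,1245728,1245954,1245746,1245235,1245987,1123090,4195090] [8264,155932670666521439240281,21066]
def kL6_46 : KLem := .mk [2,2,2,2,2,2] [0,2101248,1179648,1245728,1245954,1245746,1245235,1245987,1123090,2106130,3146514,2306834,3224338,2240528,2240816,2240802] [2418,842,2944,768,2866,2656,4976,428,6708,2348,9008,7024,3044,2784,2924,7136,2738,438,7866,13230,5840,2140,6684,1640,5244,5272,4608,1676,1206,9358,4236,360,510,11452,10932,10554,2970,7322,7094,30526,4384,6816,812,2656,946,5488,5530,1776,5172,5168,620,10720,4560,4328,6824,4120,4988,6092,4232,7014,6386,6866,5610,5582,10654,12604,13216,12570,10386,16318,28054,21018,5778,8634,9274,5526,18330,4794,1562,542,5942,30234,5682,24758,24894,58550,3908,12244,1610,5054]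
def kL6_47 : KLem := .mk [2,2,2,2,2,2] [0,2101248,1179648,1245728,1245954,1245746,1245235,1245987,1123090,2106130,3146514,2306834,3224338,2240528,2240816] [2848,4816943214692792402013,716]
def kL6_48 : KLem := .mk [2,3,2,2,2,2] [0,2101248,1179648,1245728,1245954,1245746,1245235,1245987,1123090,2106130,3146514,2306834,3224338,2240528,2240832,2240850] [5058,6062,3616,7472,6690,3714,1434,398,4030,7772,7598,14694,14954,1918,5988,32092,2878,7764,16352,7970,6606,10826,11306,22566,12770,12654,13782,5602,32258,19786,20494,45062,54570,7496,11040,6640,12144,6260,3140,10466,11496,16222,328,12152,1858,13884,14548,13144,30554,23418,28374,22468,6780,12004,11832,11308,7530,6242,31818,18536,3132,20092,20300,6504,11080,7284,7448,3660,15988,11784,22888,23042,3362,4098,6442,46378,15874,23554,17738,44642,46406,13570,23114,29542,43522,54570,45642,13610,15682,112678,3360,3358]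
def kL6_49 : KLem := .mk [2,3,2,2,2,2] [0,2101248,1179648,1245728,1245954,1245746,1245235,1245987,1123090,2106130,3146514,2306834,3224338,2240528,2240832] [5752,77071091435089224138849,9710]
def kL6_50 : KLem := .mk [2,2,2,2,2,2] [0,2101248,1179648,1245728,1245954,1245746,1245235,1245987,1123090,2106130,3146514,2306834,3224338,2240528,2240818,2240800] [3050,2898,768,2964,1376,5840,5640,5710,1034,11688,11452,23160,4630,5722,1412,11316,5760,1564,3224,11568,1166,18762,1290,3262,2396,3368,11266,6162,23376,2586,2118,5754,7408,3380,2878,7036,8100,3720,7624,7672,4792,938,2706,2616,1680,116,2804,316,6970,7008,6566,2338,1830,13350,11830,3846,10740,2336,1220,568,5898,9098,9368,15230,16202,4016,11634,2818,11264,11800,23724,4822,5838,5382,1664,1628,3244,1170,6994,262,298,6462,7626,4444,6860,7548,5214,5740,4842,5144,6584,5402,4616,5842,1046,11552,14252,3608,9368,5390,11572,9214,6962,15142,6062,11458,2966,3296,3558,4224,7636,8624,7638,3334,6914,6186,15182,12256,11106,3282,1552,1216,2208,6034,24302,11848,3904,15688,15954,6146,30274,16334,19938,5608,11848,3912,7140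,6758,5860,13548,31084,5710,22080,21066,4686,11484,3792,5102]
def kL6_51 : KLem := .mk [2,2,2,2,2,2] [0,2101248,1179648,1245728,1245954,1245746,1245235,1245987,1123090,2106130,3146514,2306834,3224338,2240528,2240818] [2336,4816943214692792402021,6104]
def kL6_52 : KLem := .mk [2,2,2,2,2,2] [0,2101248,1179648,1245728,1245954,1245746,1245235,1245987,1123090,2106130,3146514,2306834,3224338,2240528] [2360,4816943214692792402015,77071091435089224138851,86421976012890113,4816943214692792402023,4720,77071091435091371622497,9692,5810,4746,77071091439418685457507,4786,6018,5056,4728,11640,77071091439418685457507,4048,77071091435091371622499,12202,6974]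
def kL6_53 : KLem := .mk [2,2,2,2,2,2] [0,2101248,1179648,1245728,1245954,1245746,1245235,1245987,1123090,2106130,3146514,2306834,3224338] [2904,4816943214692792402025,86421974856372737,4776,86421980307857409,1914,86421974939148289,86421979234115585,6040,86421980225081857,9724,86421979151340033,9488,1726,86421980307857409,23868]
def kL6_54 : KLem := .mk [2,2,2,2,2,2] [0,2101248,1179648,1245728,1245954,1245746,1245235,1245987,1123090,2106130,3146514,2306834] [5960,4816943214692792402027]
def kL6_55 : KLem := .mk [2,2,2,2,2,2] [0,2101248,1179648,1245728,1245954,1245746,1245235,1245987,1123090,2106130,3146514] [1480,4816943214692792402029,2888]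
def kL6_56 : KLem := .mk [2,2,2,2,2,2] [0,2101248,1179648,1245728,1245954,1245746,1245235,1245987,1123090,2106130] [5192,4816943214692792402031,15178]
def kL6_57 : KLem := .mk [2,2,2,2,2,2] [0,2101248,1179648,1245728,1245954,1245746,1245235,1245987,1123090] [3144,1733947878038904833,4816943214692792401995,155932670666521439240283,4816943214692792402033,11368,193711602529478600949849,31704,12872,7114,29400,7144,14810,14664,26728,193711602529478600949851,7034,59096]
def kL6_58 : KLem := .mk [2,2,2,2,2,2] [0,2101248,1179648,1245728,1245954,1245746,1245235,1245987,2171666,1057554,3212050,2306834,3158802,8208,2240528] [7320,653584947613612033,3212,1320,1870,6856,5848,12200,7144,8146,15786,3672,7662,6942]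
def kL6_59 : KLem := .mk [2,2,2,2,2,2] [0,2101248,1179648,1245728,1245954,1245746,1245235,1245987,2171666,1057554,3212050,2306834,3158802,8208] [3016,4816943214692792402037,86439567042417153,1688,86439572493901825,1368,86439567125192705,86439571420160001,666,86439572411126273,11704,86439571337384449,11664,9374,86439572493901825,2428]
def kL6_60 : KLem := .mk [2,2,2,2,2,2] [0,2101248,1179648,1245728,1245954,1245746,1245235,1245987,2171666,1057554,3212050,2306834,3158802] [5192,4816943214692792402039,1783753433457234433,168,1783753438908719105,21272,1783753433540009985,1783753437834977281,2200,1783753438825943553,17304,1783753437752201729,4368,20606,1783753438908719105,41210]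
def kL6_61 : KLem := .mk [2,2,2,2,2,2] [0,2101248,1179648,1245728,1245954,1245746,1245235,1245987,2171666,1057554,3212050,2306834] [6472,4816943214692792402041]
def kL6_62 : KLem := .mk [2,2,2,2,2,2] [0,2101248,1179648,1245728,1245954,1245746,1245235,1245987,2171666,1057554,3212050] [4072,4816943214692792402043,7624]
def kL6_63 : KLem := .mk [2,2,2,2,2,2] [0,2101248,1179648,1245728,1245954,1245746,1245235,1245987,2171666,1057554] [4680,4816943214692792402045,14184]
def kL6_64 : KLem := .mk [2,2,2,2,2,2] [0,2101248,1179648,1245728,1245954,1245746,1245235,1245987,2171666] [3144,81120043987699201,3912,4816943777642745823307,15192,14920,11208,32600,4816943214692792402047,10312,4680,7624,8056,29640,7624,4816943777642745823347,28504,6728,5448,4816943777642745823347,19832,31578,18504,4938,2632,42584]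
def kL6_65 : KLem := .mk [2,2,2,2,2,3] [0,2101248,1179648,1245728,1245954,1245746,1245235,1245987,4268818,5448466,4195090,5255954] [10312,16200,155932671229471392661587,1896,23416,122451184192197121,24744,704026864587575809,35096,122451184274972673,122451188569939969,16540,704004874438906369,51612,122451188487164417,60240,51352,704026868882543105,99186]
def kL6_66 : KLem := .mk [2,2,2,2,2,3] [0,2101248,1179648,1245728,1245954,1245746,1245235,1245987,4268818,5448466,4195090] [15736,155932670666521439240323,32122]
def kL6_67 : KLem := .mk [2,2,2,2,2,3] [0,2101248,1179648,1245728,1245954,1245746,1245235,1245987,4268818,5448466] [2120,155932670666521439240325,7112]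
def kL6_68 : KLem := .mk [2,2,2,2,2,3] [0,2101248,1179648,1245728,1245954,1245746,1245235,1245987,4268818] [13896,193711602529478600949791,81120049231562241,193714017584778778378307,155932670666521439240327,72,19528,193715170506283385225283,58344,11096,32360,16200,10826,2634,64456,15816,14552,24650,14408,1880,12138,50536]
def kL6_69 : KLem := .mk [2,2,2,2,3,2] [0,2101248,1179648,1245728,1245954,1245746,1245235,1245987,2302738,3408658,3482386,1389330,2372370,2236432] [11080,9480,1356,9208,13256,28576,9996,14072,14272,17386,940,2684,85914395621331457,4840,85914401072816129,11578,85914395704107009,85914399999074305,21400,85914400990040577,13688,85914399916298753,48432,48348,85914401072816129,32438]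
def kL6_70 : KLem := .mk [2,2,2,2,3,2] [0,2101248,1179648,1245728,1245954,1245746,1245235,1245987,2302738,3408658,3482386,1389330,2372370] [2136,77109733239560525185163,708006650003984897,5512,3009869461484409345,16798,708006650086760449,708006654381727745,12474,3009847471335739905,24988,708006654298952193,8464,10398,3009869465779376641,120]
def kL6_71 : KLem := .mk [2,2,2,2,3,2] [0,2101248,1179648,1245728,1245954,1245746,1245235,1245987,2302738,3408658,3482386,1389330] [4426,77109733239560525185165]
def kL6_72 : KLem := .mk [2,2,2,2,3,2] [0,2101248,1179648,1245728,1245954,1245746,1245235,1245987,2302738,3408658,3482386] [15816,77109733239560525185167,376,31192]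
def kL6_73 : KLem := .mk [2,2,2,2,3,2] [0,2101248,1179648,1245728,1245954,1245746,1245235,1245987,2302738,3408658] [10312,77109733239560525185169,24168]
def kL6_74 : KLem := .mk [2,2,2,2,2,2] [0,2101248,1179648,1245728,1245954,1245746,1245235,1245987,2302738] [5192,4680,8136,4816943777642745823347,155932671229471392661641,12152,1734759317621186561,77109733239560525185171,7752,6472,3016,4816943777642745823353,9722,16344,15448,77128179983634234736785,32600,15096,9704,27754,3400,4816943777642745823361,15322,19400,24392,31834,60408]
def kL6_75 : KLem := .mk [2,2,2,2,2,3] [0,2101248,1179648,1245728,1245954,1245746,1245235,1245987,4399890] [15432,9800,193711602529478600949893,193711603655378507792521,1735322267574607873,3099424282276133461950529,10824,12106975100612849565729,193711603655378507792521,26696,3099442729020207171502143,54216,27208,32074,56664,6600,5464,13658,61256,193711604218328461213833,45384,94152]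
def kL6_76 : KLem := .mk [2,2,2,2,3,2] [0,2101248,1179648,1245728,1245954,1245746,1245235,1245987,1319698] [14440,1735355252922458113,3144,13768,6088,4816943777642745823361,77128180546584188158093,16248,19912,13176,155936238643326223515715,2120,77128179983634234736687,15354,19016,193715170506283385225283,54904,29384,16122,46936,30280,6232,13528,37960,193715170506283385225283,6138,108248]
def kL6_77 : KLem := .mk [2,2,2,2,3,2] [0,2101248,1179648,1245728,1245954,1245746,1245235,1245987,2368274] [6234,81120049356408321,4820511191497576677425,155936238643326223515715,77128179983634234736793,12872,19528,193715170506283385225283,45658,25162,77128181109534141579417,10568,77109733802510478606489,51656,47176,193715170506283385225283,15304,27352]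
def kL6_78 : KLem := .mk [2,2,2,2,3,3] [0,2101248,1179648,1245728,1245954,1245746,1245235,1245987,4465426] [14920,81120049356408321,29800,193714017584778778378307,8520,155936238643326223515715,231494102369240546934851,77128179983634234736793,25160,193714017584778778378307,43738,50248,193714017584778778378307,44616,77128181109534141579417,34888,193714017584778778378307,11226,54728,14920,77128181672484095000729,77128181672484095000731,130648,95304,269273034232197708644419,63176,60232]
def kL6_79 : KLem := .mk [2,2,2,1,2,2] [0,2101248,1179648,1245728,1245954,1245746,1245235,1245987] [1896,81120045061441025,301058893438736531469,9745791859178026958881,81120046010336769,81120048157820417,81120048282666497,4819358269992969830449,155935085721821616668739,4816943214692792402035,4816943214692792402049,155932670666521439240329,81120045925480449,4816943214692792402069,155932670666521439240343,77109733239560525185177,77109733239560525185179,2494961372468818874597533]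
def kL6_80 : KLem := .mk [2,2,2,1,2,2] [0,2101248,1179648,1245728,1245954,1245746,1245235] [1636,301058893438736531615]
def kL6_81 : KLem := .mk [2,2,2,1,2,2] [0,2101248,1179648,1245728,1245954,1245746] [3612,301058893438736531617,7316]
def kL6_82 : KLem := .mk [2,2,2,1,2,2] [0,2101248,1179648,1245728,1245954] [1808,301058893438736531619,7736]
def kL6_83 : KLem := .mk [1,2,2,1,2,2] [0,2101248,1179648,1245728] [800,1176011303567818753,3668,3748,301058893438736531621,3652,301058893713747608227,3764,3088,3296,7374,6572,6254]
def kL6_84 : KLem := .mk [2,2,2,1,2,2] [0,2101248,1179648,1245730] [1600,1176011303567818753,18816180857100894375,18816180857117671591,18816180857100829351,7248,18816180839929413799,15464,18816180857117606567,7684,18816180839929348775,15564,15536,18816180839929413799,14348,29140]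
def kL6_85 : KLem := .mk [1,1,1,1,2,2] [0,2101248,1179648] [448,1176011302494076929,1176011302485753857,18816180839921025191,1176011302477365761,18816180839920960167,18816180839786742951,301058893438736531625]
def kL6_86 : KLem := .mk [1,1,3,1,2,2] [0,2101248,1180160,1246208] [528,149217081051775147,149216943612822187,2128,2387754772205471233,12686]
def kL6_87 : KLem := .mk [1,2,2,1,2,2] [0,2101248,1180160,1245216] [544,7320707440771243,1136,9323886631192235,3140,4538949466064555,4574133838153387,3172,6790749279749803,2788,2208,11575686444877483,4568]
def kL6_88 : KLem := .mk [2,2,2,1,2,2] [0,2101248,1180160,1245728,1049378] [1552,4787578679263403,4857947423441067,3606,77406099783616001,1233994063352235693,4820289150198955,7824,78008634152125953,1243634583301064365,7300,6759275758297771,7820,4855473522287787,6532,6759275758297771,28868]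
def kL6_89 : KLem := .mk [2,2,2,1,2,2] [0,2101248,1180160,1245728,1245986] [1552,4787578679263403,4857947423441067,7320566782232235,4820289150198955,151435754858088107,3206,4507475944612523,4577844688790187,4855473522287787,14788,4507475944612523,4577844688790187]
def kL6_90 : KLem := .mk [2,2,2,1,3,2] [0,2101248,1180160,1245728,1311522] [7232,185808825876676779,188027640341528747,15440,4820289150198955,4855473522287787,2896,4787312391304363,4857681135482027,15440,4820289150198955,4855473522287787,12932,150905948091921579,10700,14022,148621162929403051,148691531673580715,8480,8588,151191683676189867,51800]
def kL6_91 : KLem := .mk [1,2,2,1,2,2] [0,2101248,1180160,1245728] [800,1176288379441053697,1804,4820289150198955,149780028857712811,7883655246708907,151998843322564779,18816110471462060207,1804,4820289150198955,2604,4820289150198955,18816110471445217967,1552,4820289150198955,4855473522287787,6672,4820289150198955,4855473522287787,301058893438736531633,301058893438736531635,4819358269992969830581,7248,4820289150198955,4855473522287787,7248,4820289150198955,4855473522287787,15376,4820289150198955,4855473522287787]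
def kL6_92 : KLem := .mk [1,2,3,1,2,2] [0,2101248,1180160,1246240] [1856,83914895044837547,3608,148935483670136491,7248,7039110059132587,14458,7332,4505981297624747,4576350041802411,6432,83633297663198891,31610]
def kL6_93 : KLem := .mk [2,2,2,1,2,2] [0,2101248,1180160,1245218,1180450] [1104,18816110471453671599,7072086817506987,301057768118942761145,5633091309871275,149748279385727147,6340,2414501438593762817,149748278311985835,2196,148621554845168811,148691923589346475,14496,301057768393820668089,185777076404691115,9722]
def kL6_94 : KLem := .mk [2,2,2,1,2,2] [0,2101248,1180160,1245218] [1088,301057767543124656305,18816110471462060215,301057767543123608241,301058893438736531643,6312,11575686444877483,4590,18816110471461995191,2184,11294348907120299,4424,4416,11610870816966315,13724,25584]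
def kL6_95 : KLem := .mk [2,2,2,1,2,2] [0,2101248,1180160,1245730] [3600,18816180839929413807,7072088963884203,301058894018581168313,301058893438870749373,7344,81629969223780011,81700337967957675,301058893438870880445,7720,81067294148265643,81137662892443307,15776,301058894293459075257,83952137781642923,15320]
def kL6_96 : KLem := .mk [2,2,3,1,2,2] [0,2101248,1180160,1246242] [3200,18816180893339680941,301058894293450686649,301058894293467463865,301058894293450621625,14352,148902498321303211,148972867065480875,301058894293467398841,15816,81067174962923179,81137543707100843,28832,301058894018581168313,151191681530332843,25298]
def kL6_97 : KLem := .mk [1,1,2,1,2,2] [0,2101248,1180160] [448,1176292777470787585,18816180876159811757,18816180839921025199,18816180839921025207,301058894018572779705,18816180839920960175,18816180839920960183,301058894018572714681,301058893438736531645,301058893438736531647,4816942304297164603585]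
def kL6_98 : KLem := .mk [1,2,3,1,2,2] [0,2101248,1180192,1246240] [3104,149184095702941867,149254464447119531,2386945531647428291,149216943612830379,2388071431554270915]
def kL6_99 : KLem := .mk [1,3,3,1,2,2] [0,2101248,1180192,1246272] [3232,18829621287524040887,83952278440181931,301201883890731712709,6176,11542709686503083,29016,6176,83600303724431019,14812,14596,4508180320880299,4543364692969131,4613733437146795,13264,160194491328497323,63192]
def kL6_100 : KLem := .mk [2,2,2,1,2,2] [0,2101248,1180192,1245698,1179698,1049378,1246000,1245219,1180419,1049139] [3394,840,44227181136650411,5962,46478980950335659,2880,5385008740114603,5420193112203435,1600,41975381322965163,3656,8768,48730780764020907,26304]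
def kL6_101 : KLem := .mk [2,2,2,1,2,2] [0,2101248,1180192,1245698,1179698,1049378,1246000,1245219,1180419] [1044,301058893438736531657,6757900296128171,3358]
def kL6_102 : KLem := .mk [2,2,2,1,2,2] [0,2101248,1180192,1245698,1179698,1049378,1246000,1245219] [1380,301058893438736531659,6758176246669995,2798]
def kL6_103 : KLem := .mk [2,2,2,1,2,2] [0,2101248,1180192,1245698,1179698,1049378,1246000] [3588,301058893438736531661,6757766077293739,7300,3126]
def kL6_104 : KLem := .mk [2,2,2,1,2,2] [0,2101248,1180192,1245698,1179698,1049378] [3664,301058893438736531663,7040750735007915,3752]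
def kL6_105 : KLem := .mk [2,2,2,1,2,2] [0,2101248,1180192,1245698,1179698] [1096,301129825130723279025,2395952696542430915,301058893438736531665,7320566781707947,7488,84477705411830443,14474,7748,6757766077293739,6212,2248,9009976060355243,9080344804532907,14480,84512889783919275,5772,32184]
def kL6_106 : KLem := .mk [2,2,2,1,2,2] [0,2101248,1180192,1245698] [3088,301129262187210211505,301057205168712712389,301058893438736531667,7039095025116331,2192,83914754385774251,4540,2616,11261499923498667,13800,6184,9009700109813419,9080068853991083,5408,83949938757863083,12538,27378]
def kL6_107 : KLem := .mk [2,2,3,1,2,2] [0,2101248,1180192,1246210] [2112,18820614071072653495,301057768118531915973,2423502092234458819,6342,301128699829985477305,4505964117231275,73227921229940419,4506376432984747,4576745177162411,72102025618065091,4576332861408939,73227925524907715,4184,151154280954594987,24620,4818095221953764786887,4488,9009563744601771,9079932488779435,8512,83668464854894251,25484,53908]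
def kL6_108 : KLem := .mk [2,2,2,1,2,2] [0,2101248,1180192,1245730] [1540,301130951303358448315,4505966263608491,73223557543167683,4506103702561451,4576472446739115,72097661931292355,4576335007786155,73223561838134979]
def kL6_109 : KLem := .mk [2,2,3,1,2,2] [0,2101248,1180192,1246242] [2112,4819429201691395883189,301057768118531915973,301057767543124656341,151435758077682347,4264,83633280482805419,26988,301057767543124787413,301057767543124787417,8512,83668464854894251,24988,18184]
def kL6_110 : KLem := .mk [2,3,3,1,2,2] [0,2101248,1180192,1246274] [12416,18820614071072653495,301057768118531915973,301057768668287729861,301057767543124656341,301057767543124656345,2423572460978636483,4816924298692603805915,301057767543124787413,301057767543124787417,4816924289896510914779,4816924298692603936987]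
def kL6_111 : KLem := .mk [1,2,2,1,2,2] [0,2101248,1180192] [896,18820684439548395687,18820684439548395703,301130951097214632121,18820684439414243511,301058894018572779717,301130951097080479929,301058894018438627525,4816942304297448702151,301130951028480541373,301058893438736531669,4816942304297164603607,301058893436590096597,301058893438736531673,4816942304297164603611,4816942304295018168535,4816942304295018168539,77071076868759179362525]
def kL6_112 : KLem := .mk [2,2,3,1,2,2] [0,2101248,1180194,1246242] [2624,301129825137162584255,149183958263997099,2388071429541004995,149184095702950059,149254464447127723,2386945533929129667,149254327008174763,2388071433835972291]
def kL6_113 : KLem := .mk [2,3,3,1,2,2] [0,2101248,1180194,1246274] [5248,301129825137162584255,301129825137162584281,4818077203154780422363,4818077203704536236251,301129825137161536217,151473278911979691,4816924298692603805921,4818077203152632939227,4816924289894363300577,8288,301129262187210211545,151191664349939371,4816915291491201582305,17024,301417492563496272089,88174263505520299,4821526978059384849633]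
def kL6_114 : KLem := .mk [3,3,3,1,2,2] [0,2101248,1180194,1246276] [8448,301129825137162584255,301129825137162584281,4818077203154780422363,4818077203704536236251,301129825137161536217,4816924289896510783713,4816924298692603805921,4818077203152632939227,4816924289894363300577,2423572463260337859,77070788779086155221219,4818077203702388753115,4816924298690456322785,77070788638352961833187,77070788779090450188515]
def kL6_115 : KLem := .mk [2,2,2,1,2,2] [0,2101248,1180194] [3584,301130951032774459561,301130951032774459583,4818095217555434242241,301130951030628024511,301130951032774459609,4818095217555434242267,4818095217553287807169,4818095217553287807195,77089523480887467049181,301130951028480541375,301130951032773411545,4818095217555433194203,301130951030625928409,4816942304297164603617,4818095217553285711067,4816942304295018168545,77071076868759179362531,4818095217551140324033,4818095217551140324059,77089523480887466001117,4818095217551139275995,4816942304292870685409,77071076868759178314467,77089523480853106263261,77071076868724818576611,1233137229900146872025317]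
def kL6_116 : KLem := .mk [1,1,1,1,1,2] [0,2101248] [64,73500706287452331,73500431426322603,1176011302494077123,73500293987434667,1176011302485754051,1176006904439374019,18816180839921025247,73500156548481707,1176011302477365955,1176006904430985923,18816180839920960223,1176004705407730883,18816180839786743007,18816110471042566367,301058893438736531687]
def kL6_117 : KLem := .mk [1,2,2,1,2,2] [0,2232320,2163200,1049120] [1544,7072347660157099,9325663597297897,1556,6757900295079595,9044187546858217,4505404621137129,2192,83914754384725675,9290497478832873]
def kL6_118 : KLem := .mk [1,2,3,1,2,2] [0,2232320,2163200,1049632] [1600,11857284825284779,9308089664864489,6160,7039110057559723,9009004248515817,4505422874747625,6160,151154298133415595,9009004248515817]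
def kL6_119 : KLem := .mk [2,2,2,1,2,2] [0,2232320,2163200,1048610] [1040,7072072782251179,18816180839929413867,301058894018581168365,4540588993224937,9044188620595433,9290479225210089,3078,150873079781000875,9044187546854121,6624,564773200802537,11894543742142123,14075572082914025]
def kL6_120 : KLem := .mk [2,2,2,1,2,2] [0,2232320,2163200,1049122] [1552,113157564170241731,283279970477289,301058894018581168365,318464342565097,9325663597306089,301058893438870880495,9290479225218281,4384,564773200802537,83952137780070059,14075572082914025]
def kL6_121 : KLem := .mk [1,1,2,1,2,2] [0,2232320,2163200] [768,75719246956527787,9042938776584425,4521746963235049,18816180839921025259,301058894018572779757,4504154777191145,18816180839920960235,301058894018572714733,301058893438736531695,301058893438736531697,2176,189716558812284611,283298224087785,301058894293467463917,300890410131689,9308089664872681,301058894293467398893,9290497478828777,8224,283279970485481,151191681528759979,13794078852596969]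
def kL6_122 : KLem := .mk [1,2,3,1,2,3] [0,2232320,4260352,5309472] [5440,83914913290059947,9312487778484457,77199685651793651,4509820988367593,21648,151154298402375339,9013402362135785]
def kL6_123 : KLem := .mk [2,2,2,1,2,3] [0,2232320,4260352,5308450] [352,4526296482906345,9029896110276841,4508704296862441,117131609497142979,3744,11575686645679787,9293795007083753,9012303924232937,6856,11294349107922603,9311386119386345,3520,11610871017768619,5071670356423913,14078869611164905]
def kL6_124 : KLem := .mk [2,2,2,1,2,3] [0,2232320,4260352,5308962] [4368,1803026480872031979,7072107209106603,72095754974136051,322862456185065,9330061710926057,9745791859178161307895,9294877338838249,29984,569171314422505,83952138049029803,14079970196533993]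
def kL6_125 : KLem := .mk [2,2,3,1,2,3] [0,2232320,4260352,5309474] [576,4526296482906345,9029896110276841,4508704296862441,2422974618710836931,11488,11575686645679787,9293795007083753,9012303924232937,9352,11294349107922603,9311386119386345,2880,11610871017768619,5071670356423913,14078869611164905]
def kL6_126 : KLem := .mk [1,1,2,1,2,3] [0,2232320,4260352] [1088,12701846112108715,9325547624661225,81146365467623667,4522880835649769,9745791859757863207157,81146365459235571,4505288649605865,9745791859757863142133,9745791859178026959095,9745791859178026959097,155932669756125811441915]
def kL6_127 : KLem := .mk [2,2,2,1,2,2] [0,2232320,66080,2163250] [796,1730265199392655083,319562847564521,36988099353614485245,6791297952326827,9378301635343081,94611210490349299,9326762102305513,36988099357909452541]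
def kL6_128 : KLem := .mk [2,2,2,1,2,3] [0,2232320,66080,4260402] [5392,3243474674188814059,12701585268483243,72139391841863411,318348371501289,9325547626242281,36965627534965999357,9290363253699305,36965627539260966653]
def kL6_129 : KLem := .mk [2,2,3,1,2,2] [0,2232320,66080,2163762] [576,4593229178667241,9096828806037737,4504306250359529,2422983071206475459,1320738057523824381,9007905877730025,1298220059428914941,9745791859175880655105]
def kL6_130 : KLem := .mk [1,2,2,1,2,2] [0,2232320,66080] [136,7072346594803883,1810870090137207019,81102387183550707,4593228104990953,9096827732361449,9324564152778985,36974590532455170301,36974590534602653949,81102384994256627,320,4593229178667241,9096828806037737,4504306250359529,117140061992781507,1319612157616981757,9007905877730025,1297094159522072317,14976,12736770714313387,5068238603559657,14075437858300649,7440,283163997909737,202701997295273667,36974590535676395773,4540473022161129,9044072649531625,9290363252650729,18590958647480420093,17696,569171314422505,11894565208535723,14079970196533993,4504305176618217,301058893438736531711,9745791859178026959105,36974590532413359869,4816942304297164603651,608,4593229178667241,9096828806037737,13600428433408233,4504306250359529,2401601968092743421,2423018255578564291,2545717156168599293,9007905877730025,301058893436590227711,1298220059563132669,14468158342045525868801]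
def kL6_131 : KLem := .mk [2,2,3,1,2,2] [0,2232320,2163232,1049634] [2176,189716558812284611,283298224087785,18595455445875558141,300890410131689,9308089664872681,18590951846256576253,9290497478828777,25280,564772127069417,83670681056970411,14075571009180905]
def kL6_132 : KLem := .mk [2,3,3,1,2,2] [0,2232320,2163232,1049666] [4352,190279508765705923,36970141925547181821,283298224095977,37114257113623037693,582365386842345,5085965014212841,14093164268953833,18590951848404059901,4816942308695211245831,9290497478836969,17536,564789306938601,160231874722268843,14075588189050089]
def kL6_133 : KLem := .mk [1,2,2,1,2,2] [0,2232320,2163232] [512,4539339149213929,9042938776584425,4521746963235049,1211507951043543235,1306635498055467261,9025346590605545,1302131898436485373,18744158464631701765,4504154777191145,18744158430255121157,18744158464614859525,18744158430120903941,1028,108653964551259843,300871082779881,18599919463092717309,318463268823785,9325662523564777,18595415863473735421,9308070337520873,19384056916837730053,4816942304297164603655,18744158464480642309,4816942304295018168583,77071076868759179362569]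
def kL6_134 : KLem := .mk [2,2,2,1,2,3] [0,2232320,4260384,5308930] [280,321762944549097,9328962199290089,1152959523809134323,7039113270338731,1152959528104101619,38046447671228237565,9012302850499817,38046447675523204861]
def kL6_135 : KLem := .mk [2,2,3,1,2,3] [0,2232320,4260384,5309442] [6720,304171832246505,9311371086987497,2423502384292169411,4508704296870633,18596546571714430717,1298220405006010109,9012303924241129,10272,4508703223129321,151156480178652843,13515902477870313]
def kL6_136 : KLem := .mk [2,2,3,1,2,3] [0,2232320,4260384,5309474] [8832,72696084019545843,83914775851115179,72696088314513139,305288523751657,9312487778492649,36966184231438649085,9294895592448745,36966184235733616381]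
def kL6_137 : KLem := .mk [2,3,3,1,2,3] [0,2232320,4260384,5309506] [21760,12106975100694469607669,1343236747500979907,287696337715945,38267742117939644157,586763500462313,5090363127832809,14097562382573801,155932669760523858084111,18591515348248037117,9294895592456937,78656,287695263974633,227752875463018155,13798494146086121]
def kL6_138 : KLem := .mk [1,2,2,1,2,3] [0,2232320,4260384] [3712,203229539546104003,300756184989929,12106975100677289738485,318348370968809,9325547625709801,12106975100677155586293,9307955439730921,608,304171832246505,151473297157193899,13814970714357993,2383570323007866621,4508704296870633,2383570323007866611,57723802544136521469,12106975100608555647735,9745791859178026959117,155932669756125811441935,9745791859175880524045,4505288649614057,155932669756125811441937,155932669756123665006863,155932669756123665006865,2494922716098017528774931]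
def kL6_139 : KLem := .mk [2,3,2,1,2,2] [0,2232320,66082,2163522] [592,282180525958377,1176603095418537715,38070091242837640957,151154968139866283,9096827732369641,9289379780699369,1176603099713505011,38070091247132608253]
def kL6_140 : KLem := .mk [2,3,2,1,2,3] [0,2232320,66082,4260674] [9856,12106975100887995908345,1301622102982133491,283163999486697,56641854324110788349,582231162233065,12739107176521899,14093030044344553,1301622107277100797,1301622107277100787,9290363254227689,56641854328405755645]
def kL6_141 : KLem := .mk [3,3,2,1,2,2] [0,2232320,66082,2163524] [1360,18631449041342629629,565871705797865,609111991215831712021,1338143485505308355,5069471333168361,18614030820935730941,371120634740969,9378319889481961,38263235992913446653,14076670587909353,6668,371119560999657,227472086329930923,13881918443111145]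
def kL6_142 : KLem := .mk [3,3,2,1,2,3] [0,2232320,66082,4260676] [21760,12106975100887996039417,38046509059187410685,564638976197353,193711601620180472693009,38051012658806392573,203825717640431299,5068238603567849,38267185440920176381,582231162241257,5085830789611753,14093030044352745,193711601620178325209873,38262681841301194493,14075437858308841,5280,568070729053417,5071670356423913,227790261802185899,18582469238535401]
def kL6_143 : KLem := .mk [2,2,2,1,2,2] [0,2232320,66082] [320,117658947594553027,30126842946801238257,38069499450986922237,282181599699689,18816180857100894475,609111991215806546197,18595420244323665661,18816180857117671691,609111991215823323413,299773785743593,18816180857100829451,609111991215806481173,4593229178675433,9096828806045929,9306973040484585,4816942295024330211607,155932669746852977049881,18590916644704683773,18816180857117606667,609111991215823258389,9289380854440681,4816942295024329163543,155932669746852976001817,1056,282180525958377,2379064197981669117,2379064200129152765,4593228104999145,9096827732369641,151191664282306219,2379064197981669107,2379064200129152755,13792979408069865,57719296419110323965,57719296421257807613,77071076720389285609755,2494922715949647635022109]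
def kL6_144 : KLem := .mk [2,3,2,1,2,3] [0,2232320,2163234,4260674] [14976,12106975100887995908345,1302185052935554803,283163999486697,56642417274064209661,582231162233065,84796701214449835,14093030044344553,1302185057230522109,1302185057230522099,9290363254227689,56642417278359176957]
def kL6_145 : KLem := .mk [3,3,2,1,2,3] [0,2232320,2163234,4260676] [17664,12106975100887996039417,38047072009140831997,564638976197353,193711601620180472693009,38051575608759813885,1356747222247278275,5068238603567849,38267748390873597693,582231162241257,5085830789611753,14093030044352745,193711601620178325209873,38263244791254615805,14075437858308841,21888,568070729053417,5071670356423913,227790261802185899,18582469238535401]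
def kL6_146 : KLem := .mk [2,2,2,1,2,2] [0,2232320,2163234] [320,1882683899146929887,30126842946801238255,38069499450986922237,301058893436724314367,284380622955241,609111991215806546197,4816942296048815177987,18816180857117671691,609111991215823323413,301058893434576831231,301972808999145,609111991215806481173,371104528015593,9378303782756585,4816942299418350190871,9309172063740137,155932669746852977049889,4816942296046667694851,18816180857117606667,609111991215823258389,4816942299418349142807,9291579877696233,155932669746852976001825,77071076790693603311899,1200,2379064195968403197,284379549213929,2379064200263370493,371103454339305,9378302709080297,2379064195968403187,151191664416523947,2379064200263370483,57719296417097058045,13795178431325417,57719296421392025341,2494922715949647635022115]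
def kL6_147 : KLem := .mk [2,3,3,1,2,3] [0,2232320,4260386,5309506] [5248,155932669756400957784315,286579646210793,2383570320994600691,57723802542123255549,304171832254697,151473297157202091,13814970714366185,2383570325289567997,9293778900951785,2383570325289567987,57723802546418222845]
def kL6_148 : KLem := .mk [3,3,3,1,2,3] [0,2232320,4260386,5309508] [43520,193711601611111513850107,38047065738488579837,569171314426601,3099385625777785009209619,38051569338107561725,1343236749782681283,5072770941797097,38267742120221345533,586763500470505,5090363127841001,14097562382581993,3099385625777785008161555,38263238520602363645,14079970196538089,139904,569170240685289,5072769868055785,227790258858362539,18583568750167273]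
def kL6_149 : KLem := .mk [2,2,2,1,2,3] [0,2232320,4260386] [4352,3251672632751294175,12106975100612849565945,193711601610836635943163,12106975100610703130873,283163998954217,193711601610836635943185,193711601610834489508091,193711601610834489508113,3099385625773386694263059,12106975100608555647737,300756184998121,193711601610836634895121,318348370977001,9325547625717993,193711601610834487411985,9307955439739113,2494922716098017528774951,193711601610832342024955,193711601610832342024977,3099385625773386693214995,193711601610832340976913,9290363253695209,2494922716098017527726887,3099385625773352333477139,2494922716097983167989031,39918763457568280462623017]
def kL6_150 : KLem := .mk [1,1,1,1,2,2] [0,2232320] [32,75438183214547115,9095576813633769,4539475514425577,1176011302494077171,38069499449913180413,4521883328446697,1176011302485754099,38069499449904857341,18816180839921025285,18816180839921025291,609111991198626677013,4504291142402793,1176011302477366003,38069499449896469245,18816180839920960261,18816180839920960267,609111991198626611989,18816180839786743045,18816180839786743051,609111991198492394773,301058893438736531743,301058893438736531749,9745791859178026959147]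
def kL6_151 : KLem := .mk [2,2,3,1,3,2] [0,2232832,1311264,1377282] [6784,283298559623913,1342110830414333635,1302196359302809341,4523015396335849,9026615023706345,9290497814364905,18591515326773266173,144469267439159085]
def kL6_152 : KLem := .mk [2,3,2,1,3,2] [0,2232832,1311264,1376322] [7200,283297485882601,1337609429810218691,1306697759906924285,4540606508638441,9044206136008937,9290496740623593,18591513127758399229,144750741342127917]
def kL6_153 : KLem := .mk [2,3,3,1,3,2] [0,2232832,1311264,1377346] [28928,18635992240576725245,1343236730321176259,283298559640297,38267742100759840509,582365722386665,5085965349757161,14093164604498153,9361278618044205,18591515331068233469,9290497814381289,225534060731828013]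
def kL6_154 : KLem := .mk [1,2,2,1,3,2] [0,2232832,1311264] [1536,198725957098602691,300892550201577,18599963443557761277,318484736180457,9325683990921449,18595459843938779389,9308091804942569,149254481626988845,1154473225036564235,4820297740133677,77109732329164897386799,5101772716843821,4505425014825705,149216960792699693,77109732319892062994737,148935485815989549,1233755717266642903892275]
def kL6_155 : KLem := .mk [2,3,3,1,3,2] [0,2232832,1311776,1376834] [8512,300890678558953,9308089933299945,13811689560670441,20757746610091132669,4505423143183081,1342708825287624387,20973919392204916477,4855479966893869,9009022770553577,1297692622513309437,221028262080677677]
def kL6_156 : KLem := .mk [2,3,4,1,3,2] [0,2232832,1311776,1377858] [18688,300890678558953,9308089933299945,13811689560670441,20758872509997975293,4505423143183081,3648551834501318339,20975045292111759101,4855479966893869,9009022770553577,1298818522420152061,221028262080677677]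
def kL6_157 : KLem := .mk [1,2,3,1,3,2] [0,2232832,1311776] [3072,199288907052024003,36974649923229384957,300892551250153,37118765111305240829,599959712891113,5103559340261609,14110758595002601,18595459846086263037,81700487216431405,9308091805991145,225815675292287277,1154473259396302603,77128179073238605890351,4820297740141869,41938719574436349749,9605372344214317,81662966382142253,4505425015874281,225778154457998125,41794006254316685109,1233755717266642903892279,148935485815997741,19740091478666456171938105]
def kL6_158 : KLem := .mk [2,2,2,1,2,2] [0,2232832,1179682] [1040,113161962216686787,283280104686825,18608928861362259197,1297919910311102219,19384373232571263237,301209891874568995125,2450841414917949195,144680355416508205,19888603217503848245,353648706199785,9360847960940777,5664977147076909,4540589127442665,149780165222932781,5700161519165741,9044188754813161,149815349595021613,18590914462886331645,9290479359427817,149817273740363053,19888462480535586613,72693130122757933,318217652546838857531,19888462480552363829,144750724160685869,318217652546855634747]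
def kL6_159 : KLem := .mk [2,2,2,1,3,2] [0,2232832,1310754] [7168,198723758066959555,1351671477157560573,2451509917584983819,283300363117289,72622781778567981,144680375816495917,18595459843922003197,77128179063961746014513,41794006251917674293,300892549161193,72622919217520941,144680513255448877,4540609386848489,9044209014218985,9308091803902185,72693287961698605,144750881999626541,18590956244303021309,77128179063961744966449,41793971067679803189,9290499617858281,72693150522745645,144750744560673581,148972869211325741,668704101097460074299,668704101097476851515]
def kL6_160 : KLem := .mk [2,2,2,1,2,2] [0,2232832,1180194] [2304,4539475514425577,9043075141796073,4521883328446697,18456174862235928325,144713464177426733,9025482955817193,72691054511587629,144748648549515565,4504291142402793,18528232456273790725,144713326738473773,18600290050177500933,19312069897534572255,20906133059391194901,144431851761763629,20834075465487484693,4943890689269674542907,9007890769773289,72690917072634669,144748511110562605,72409442095924525,20762017871449622293,4943890689269540390715,144467036133852461,4966795426291313288507,4800910400026064453951]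
def kL6_161 : KLem := .mk [3,3,3,1,3,2] [0,2232832,1311266,1377348] [58112,3172015523596601093,38047065721308776189,564773536350953,225465891010905901,38051569320927758077,1343236732602877635,5068373163721449,38267742103041541885,582365722394857,5085965349765353,14093164604506345,9398662013388589,38263238503422559997,14075572418462441,225571444127172397]
def kL6_162 : KLem := .mk [2,2,2,1,3,2] [0,2232832,1311266] [3840,3179615313591273183,1351671477157560573,297599415096937809685,1226530819074426629,283300364165865,149183975443866413,297527357503034099477,148902500467156269,1234050865171818230186295,1154473225036564229,300892550209769,149184112882819373,318484736188649,9325683990929641,5139293551141165,9308091804950761,149254481626997037,297455299908996237077,4857681135478061,1234050865171818229138231,5139156112188205,9290499618906857,149254344188044077,813981217329569204027,148972869211333933,19740091476266286464500035]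
def kL6_163 : KLem := .mk [3,3,4,1,3,2] [0,2232832,1311778,1377860] [107136,2595554736916662021,283298492523241,20754368912660694781,220960092359755565,300890678567145,9308089933308137,13811689560678633,20758872512279676669,9290497747264233,3648551836783019715,20975045294393460477,4892863362238253,13794097374634729,20970541694774478589,221065645476022061]
def kL6_164 : KLem := .mk [2,2,3,1,3,2] [0,2232832,1311778] [6144,3188622512846014175,1351671477157560573,2451509917584983813,593900241780897482517,1226530853434164997,81629981033308973,283300365214441,225745169109164845,297527357537393837845,1234050865171818230186291,148902500467164461,19744813843038259465290041,1154473259396302597,81630118472261933,300892551258345,225745306548117805,599959712899305,5103559340269801,14110758595010793,9642893178511661,81700487216439597,9308091805999337,225815675292295469,297455299943355975445,1234050865171818229138227,4857681135486253,19744813843038259464241977,9642755739558701,81700349777486637,9290499619955433,225815537853342509,813981217329585981243,19744813842749091683238211,148972869211342125,315841463658663298753233223]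
def kL6_165 : KLem := .mk [1,1,2,1,2,2] [0,2232832] [256,4574386073960681,9077985701331177,4539339149213929,1211512331918442691,1315642680138596605,9042938776584425,1306635480900632829,145311736998723885,4521746963235049,73218821149819181,145276415187747117,72655871204852013,1234444522055926027,301209891874560606517,144713465242779949,301209821506084864309,4819358270572806078779,4504154777191145,73218683710866221,145276277748794157,72655733765899053,1162386928017998603,301209891874560541493,144713327803826989,301209821506084799285,4819358270572806013755,72374258789188909,301058893438736531773,4819358269992969830719,301057767543124656445,301058893438736531777,4819358269992969830725,4819357144097357955391,4819357144097357955397,77109732329164897386825]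
def kL6_166 : KLem := .mk [2,2,3,1,2,3] [0,2232864,4260898] [14848,3260679832006035167,591594433681177970453,2451544827079165701,593900276690391664405,1226565762928346885,19322026593949328133,283164000002793,225745170174518061,297527392446888019733,834725355765278705467,148902501532517677,834743370163788187451,1154508168890484485,81630119537615149,300756186046697,225745307613471021,599823347687657,5103422975058153,14110622229799145,9642894243864877,81700488281792813,9307955440787689,225815676357648685,297455334852850157333,834725355765144553275,4857682200839469,834743370163654035259,9642756804911917,81700350842839853,9290363254743785,225815538918695725,832427957005249021755,1307207815324763979,148972870276695341,3613050824538457931]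
def kL6_167 : KLem := .mk [2,3,3,1,2,3] [0,2232864,4260930] [17408,3260679866365773535,591594433715537708821,2451544861438904069,593900276724751402773,591522376121633998613,21698766044186870037,81348507121960237,834743370711396517691,2379487267535193861,81629982098670381,283164000010985,225745170174526253,593828219130847692565,834725356317182003003,225463695197816109,834743370715691484987,1154508168907261701,81632318560870701,582231162757353,225747506636726573,9609908895031597,81667502932959533,5085830790127849,225782691008815405,599823348736233,5103422976106729,14110622230847721,9680277639209261,81737871677137197,14093030044868841,225853059752993069,297455334852866934549,834725355765161330491,9361281828209965,834743370163670812475,834724792815207974715,5554793837364519379775,81418875866137901,3612523058957125451,9642756804920109,81700350842848045,9290363254751977,225815538918703917,834742807213717456699,1307805949650274123,225534063941993773,3613648958863968075]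
def kL6_168 : KLem := .mk [1,2,2,1,2,2] [0,2232864] [128,4591977186263273,9095576813633769,4539475514425577,18528231906920759557,145558026529603885,9043075141796073,73535616863764781,145593210901692717,4521883328446697,18600289500958621957,145557889090715949,18816462282669752581,19312174901029306591,21122305291883446549,144713464177426733,20906132510172315925,4943892369323576066363,9025482955817193,73535479424876845,145593073462804781,72691054511587629,20834074916134453525,4943892369323441914171,144748648549515565,4943890680473581846843,2329491378326929739,4504291142402793,73500157613835053,145557751651762989,72655732700545837,308991984179954591037,2328928426217636683,144713326738473773,1176569871564211019,2329491376171057995,72374257723835693,308991984182102074173,2328926227194381643,308991984188541379389,18597627900482036517,4943892369319030432581,2315415428312401739,4943890680469173314373,155932669756125811441997,144431851761763629,1176567672540955979,2329489177147802955,1163056873658976075,4943890117519219893573,155932669756123665006925,2315978378265823051,155877329523902539497805,2494922716098017528774991]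
def kL6_169 : KLem := .mk [2,2,2,1,2,2] [0,2232866] [1024,4574386073960681,9077985701331177,4539339149213929,73218958588707117,145276552626635053,9042938776584425,73254142960795949,145311736998723885,4521746963235049,73218821149819181,145276415187747117,72655871204852013,295299351953931248415,4962338550958182638399,144713465242779949,4962337425058277892927,2324987793731944779,9025346590605545,73254005521908013,145311599559835949,72691055576940845,4962336862108324472127,2324424845926007115,144748649614868781,1172066291272581451,2324987795879428427,4504154777191145,73218683710866221,145276277748794157,72655733765899053,296452273458538094879,4962338550960330121535,144713327803826989,4962337425060425376063,2324987793723556683,72374258789188909,297605194963143893279,4962338550962476556607,299911037968062619935,310147156971122335975,336804526115481723179,4962337425066864681279,334498683110562996523,79397416807157315150153,144431852827116845,4962336862112619438399,2324985594700301643,4962336862116912308543,333345761605957198123,79397416807155168715081,2315978395445626699,79397398792756661330249,86221958685627778081103,9007754404561641,73253868082955053,145311462120882989,72690918137987885,4962336299160518534463,2324424845917619019,144748512175915821,1172066291264193355,2324987795871040331,72409443161277741,4962336299162666017599,2324422646894363979,4962336299166958887743,332192840101350351659,79397416807153021231945,2315415447639689035,79397398792754513847113,86221958685627777033039,1444670371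99205677,1172064092240938315,2324985596847785291,1163056892986263371,79397389785555259106633,86221958685593417295183,2315978397593110347,85631662875234711644495,37199804734101260113]
def kL6_170 : KLem := .mk [1,1,1,1,1,1] [0] [16,4592113551474921,4574658804383977,73500706287452461,4539474449072361,73500431426322733,73218956458000685,1176011302494077259,4521882263093481,73500293987434797,73218819019112749,1176011302485754187,72655869065822509,1176006904439374155,1171503304812069195,18816180839921025361,4504290077049577,73500156548481837,73218681580159789,1176011302477366091,72655731626869549,1176006904430986059,1171503304803681099,18816180839920960337,72374256650159405,1176004705407731019,1171501105780426059,18816180839786743121,1162493906525686091,18816110471042566481,18744052877004639057,301058893438736531795]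
def kTab6 : KTree := .node (.node (.node (.node (.node (.node (.node (.node (.leaf kL6_0) (.leaf kL6_128)) (.leaf kL6_64)) (.node (.node (.leaf kL6_32) (.leaf kL6_160)) (.leaf kL6_96))) (.node (.node (.node (.leaf kL6_16) (.leaf kL6_144)) (.leaf kL6_80)) (.node (.leaf kL6_48) (.leaf kL6_112)))) (.node (.node (.node (.node (.leaf kL6_8) (.leaf kL6_136)) (.leaf kL6_72)) (.node (.node (.leaf kL6_40) (.leaf kL6_168)) (.leaf kL6_104))) (.node (.node (.node (.leaf kL6_24) (.leaf kL6_152)) (.leaf kL6_88)) (.node (.leaf kL6_56) (.leaf kL6_120))))) (.node (.node (.node (.node (.node (.leaf kL6_4) (.leaf kL6_132)) (.leaf kL6_68)) (.node (.node (.leaf kL6_36) (.leaf kL6_164)) (.leaf kL6_100))) (.node (.node (.node (.leaf kL6_20) (.leaf kL6_148)) (.leaf kL6_84)) (.node (.leaf kL6_52) (.leaf kL6_116)))) (.node (.node (.node (.node (.leaf kL6_12) (.leaf kL6_140)) (.leaf kL6_76)) (.node (.leaf kL6_44) (.leaf kL6_108))) (.node (.node (.node (.leaf kL6_28) (.leaf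 kL6_156)) (.leaf kL6_92)) (.node (.leaf kL6_60) (.leaf kL6_124)))))) (.node (.node (.node (.node (.node (.node (.leaf kL6_2) (.leaf kL6_130)) (.leaf kL6_66)) (.node (.node (.leaf kL6_34) (.leaf kL6_162)) (.leaf kL6_98))) (.node (.node (.node (.leaf kL6_18) (.leaf kL6_146)) (.leaf kL6_82)) (.node (.leaf kL6_50) (.leaf kL6_114)))) (.node (.node (.node (.node (.leaf kL6_10) (.leaf kL6_138)) (.leaf kL6_74)) (.node (.node (.leaf kL6_42) (.leaf kL6_170)) (.leaf kL6_106))) (.node (.node (.node (.leaf kL6_26) (.leaf kL6_154)) (.leaf kL6_90)) (.node (.leaf kL6_58) (.leaf kL6_122))))) (.node (.node (.node (.node (.node (.leaf kL6_6) (.leaf kL6_134)) (.leaf kL6_70)) (.node (.node (.leaf kL6_38) (.leaf kL6_166)) (.leaf kL6_102))) (.node (.node (.node (.leaf kL6_22) (.leaf kL6_150)) (.leaf kL6_86)) (.node (.leaf kL6_54) (.leaf kL6_118)))) (.node (.node (.node (.node (.leaf kL6_14) (.leaf kL6_142)) (.leaf kL6_78)) (.node (.leaf kL6_46) (.leaf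 kL6_110))) (.node (.node (.node (.leaf kL6_30) (.leaf kL6_158)) (.leaf kL6_94)) (.node (.leaf kL6_62) (.leaf kL6_126))))))) (.node (.node (.node (.node (.node (.node (.node (.leaf kL6_1) (.leaf kL6_129)) (.leaf kL6_65)) (.node (.node (.leaf kL6_33) (.leaf kL6_161)) (.leaf kL6_97))) (.node (.node (.node (.leaf kL6_17) (.leaf kL6_145)) (.leaf kL6_81)) (.node (.leaf kL6_49) (.leaf kL6_113)))) (.node (.node (.node (.node (.leaf kL6_9) (.leaf kL6_137)) (.leaf kL6_73)) (.node (.node (.leaf kL6_41) (.leaf kL6_169)) (.leaf kL6_105))) (.node (.node (.node (.leaf kL6_25) (.leaf kL6_153)) (.leaf kL6_89)) (.node (.leaf kL6_57) (.leaf kL6_121))))) (.node (.node (.node (.node (.node (.leaf kL6_5) (.leaf kL6_133)) (.leaf kL6_69)) (.node (.node (.leaf kL6_37) (.leaf kL6_165)) (.leaf kL6_101))) (.node (.node (.node (.leaf kL6_21) (.leaf kL6_149)) (.leaf kL6_85)) (.node (.leaf kL6_53) (.leaf kL6_117)))) (.node (.node (.node (.node (.leaf kL6_13) (.leaf kL6_141))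 (.leaf kL6_77)) (.node (.leaf kL6_45) (.leaf kL6_109))) (.node (.node (.node (.leaf kL6_29) (.leaf kL6_157)) (.leaf kL6_93)) (.node (.leaf kL6_61) (.leaf kL6_125)))))) (.node (.node (.node (.node (.node (.node (.leaf kL6_3) (.leaf kL6_131)) (.leaf kL6_67)) (.node (.node (.leaf kL6_35) (.leaf kL6_163)) (.leaf kL6_99))) (.node (.node (.node (.leaf kL6_19) (.leaf kL6_147)) (.leaf kL6_83)) (.node (.leaf kL6_51) (.leaf kL6_115)))) (.node (.node (.node (.node (.leaf kL6_11) (.leaf kL6_139)) (.leaf kL6_75)) (.node (.leaf kL6_43) (.leaf kL6_107))) (.node (.node (.node (.leaf kL6_27) (.leaf kL6_155)) (.leaf kL6_91)) (.node (.leaf kL6_59) (.leaf kL6_123))))) (.node (.node (.node (.node (.node (.leaf kL6_7) (.leaf kL6_135)) (.leaf kL6_71)) (.node (.node (.leaf kL6_39) (.leaf kL6_167)) (.leaf kL6_103))) (.node (.node (.node (.leaf kL6_23) (.leaf kL6_151)) (.leaf kL6_87)) (.node (.leaf kL6_55) (.leaf kL6_119)))) (.node (.node (.node (.node (.leaf kL6_15)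 (.leaf kL6_143)) (.leaf kL6_79)) (.node (.leaf kL6_47) (.leaf kL6_111))) (.node (.node (.node (.leaf kL6_31) (.leaf kL6_159)) (.leaf kL6_95)) (.node (.leaf kL6_63) (.leaf kL6_127)))))))

theorem kC1 : kChk 1 kTab1 0 1 = true := by decide +kernel

theorem kC2 : kChk 2 kTab2 0 1 = true := by decide +kernel

theorem kC3 : kChk 3 kTab3 0 1 = true := by decide +kernel

theorem kC4 : kChk 4 kTab4 0 3 = true := by decide +kernel

theorem kC5 : kChk 5 kTab5 0 14 = true := by decide +kernel

theorem kC6_1 : kChk 6 kTab6 0 19 = true := by decide +kernel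

theorem kC6_2 : kChk 6 kTab6 19 19 = true := by decide +kernel

theorem kC6_3 : kChk 6 kTab6 38 19 = true := by decide +kernel

theorem kC6_4 : kChk 6 kTab6 57 19 = true := by decide +kernel

theorem kC6_5 : kChk 6 kTab6 76 19 = true := by decide +kernel

theorem kC6_6 : kChk 6 kTab6 95 19 = true := by decide +kernel

theorem kC6_7 : kChk 6 kTab6 114 19 = true := by decide +kernel

theorem kC6_8 : kChk 6 kTab6 133 19 = true := by decide +kernel

theorem kC6_9 : kChk 6 kTab6 152 19 = true := by decide +kernel

theorem kC6_all : ∀ i < 170 + 1, kChk1 6 kTab6 i = true := by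
  intro i hi
  by_cases h1 : i < 19
  · exact kChk_sound kC6_1 i (by omega) (by omega)
  by_cases h2 : i < 38
  · exact kChk_sound kC6_2 i (by omega) (by omega)
  by_cases h3 : i < 57
  · exact kChk_sound kC6_3 i (by omega) (by omega)
  by_cases h4 : i < 76
  · exact kChk_sound kC6_4 i (by omega) (by omega)
  by_cases h5 : i < 95
  · exact kChk_sound kC6_5 i (by omega) (by omega)
  by_cases h6 : i < 114
  · exact kChk_sound kC6_6 i (by omega) (by omega)
  by_cases h7 : i < 133
  · exact kChk_sound kC6_7 i (by omega) (by omega)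
  by_cases h8 : i < 152
  · exact kChk_sound kC6_8 i (by omega) (by omega)
  exact kChk_sound kC6_9 i (by omega) (by omega)

/-- Keller's conjecture holds in dimensions `d ≤ 6`: in every cube tiling
`[0,1)^d + T` of `ℝ^d` with `1 ≤ d ≤ 6` there is a twin pair. -/
theorem keller_dim_le_six (d : ℕ) (hd1 : 1 ≤ d) (hd : d ≤ 6)
    (T : Set (Fin d → ℝ)) (hT : IsCubeTiling d T) : HasTwinPair d T := by
  interval_cases d
  · exact kMain kTab1 0 (fun i hi => kChk_sound kC1 i (Nat.zero_le i) (by omega)) rfl hT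
  · exact kMain kTab2 0 (fun i hi => kChk_sound kC2 i (Nat.zero_le i) (by omega)) rfl hT
  · exact kMain kTab3 0 (fun i hi => kChk_sound kC3 i (Nat.zero_le i) (by omega)) rfl hT
  · exact kMain kTab4 2 (fun i hi => kChk_sound kC4 i (Nat.zero_le i) (by omega)) rfl hT
  · exact kMain kTab5 13 (fun i hi => kChk_sound kC5 i (Nat.zero_le i) (by omega)) rfl hT
  · exact kMain kTab6 170 kC6_all rfl hT
end

section
/- Let V ⊆ S^d be a polybox code that is a cover of a word w ∈ S^d such that w̆ ∩ v̆ ≠ ∅ for every v ∈ V. If V does not contain a twin pair, then the suit F = {w̆ ∩ v̆ : v ∈ V} for the box w̆ does not contain a twin pair of boxes. -/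
/-- Two words `u, v ∈ S^d` are dichotomous if `v j = (u j)'` for some coordinate `j`. -/
def Dichotomous {S : Type*} (c : S → S) {d : ℕ} (u v : Fin d → S) : Prop :=
  ∃ j, v j = c (u j)

/-- Two words form a twin pair if they differ by complementation at exactly one
coordinate and agree elsewhere. -/
def TwinPair {S : Type*} (c : S → S) {d : ℕ} (u v : Fin d → S) : Prop :=
  ∃ j, v j = c (u j) ∧ ∀ i, i ≠ j → u i = v i

/-- A polybox code: a set of pairwise dichotomous words. -/
def PolyboxCode {S : Type*} (c : S → S) {d : ℕ} (V : Finset (Fin d → S)) : Prop :=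
  ∀ u ∈ V, ∀ v ∈ V, u ≠ v → Dichotomous c u v

/-- A code without twin pairs. -/
def TwinPairFree {S : Type*} (c : S → S) {d : ℕ} (V : Finset (Fin d → S)) : Prop :=
  ∀ u ∈ V, ∀ v ∈ V, ¬ TwinPair c u v

/-- `ES`: the collection of all `B ⊆ S` containing exactly one letter from each
complementary pair `{s, s'}`. -/
def ESet {S : Type*} (c : S → S) : Set (Set S) :=
  {B | ∀ s : S, Xor' (s ∈ B) (c s ∈ B)}

/-- The equicomplementary realization `v̆ = Ev₁ × ⋯ × Ev_d` of a word `v`,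
where `Es = {B ∈ ES : s ∈ B}`. -/
def WordBox {S : Type*} (c : S → S) {d : ℕ} (v : Fin d → S) : Set (Fin d → Set S) :=
  {x | ∀ i, x i ∈ ESet c ∧ v i ∈ x i}

/-- `⋃ E(V)`, the union of the equicomplementary realizations of the words of `V`. -/
def CodeReal {S : Type*} (c : S → S) {d : ℕ} (V : Finset (Fin d → S)) :
    Set (Fin d → Set S) :=
  ⋃ v ∈ V, WordBox c v

/-- The word `w` is covered by the code `V`, i.e. `w̆ ⊆ ⋃ E(V)`. -/
def Covered {S : Type*} (c : S → S) {d : ℕ} (w : Fin d → S)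
    (V : Finset (Fin d → S)) : Prop :=
  WordBox c w ⊆ CodeReal c V

/-- Codes `V` and `W` are equivalent: `⋃ E(V) = ⋃ E(W)`. -/
def EquivalentCodes {S : Type*} (c : S → S) {d : ℕ} (V W : Finset (Fin d → S)) : Prop :=
  CodeReal c V = CodeReal c W

/-- `Es = {B ∈ ES : s ∈ B}`, the realization of the letter `s`. -/
def LetterSet {S : Type*} (c : S → S) (s : S) : Set (Set S) :=
  {B | B ∈ ESet c ∧ s ∈ B}

/-- Two boxes `K, G` (given componentwise) in the `d`-box `X` (given componentwise)
form a twin pair of boxes: `K j = X j \ G j` for some `j` and `K i = G i` for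
every `i ≠ j`. -/
def BoxTwinPair {S : Type*} {d : ℕ} (X K G : Fin d → Set (Set S)) : Prop :=
  ∃ j, K j = X j \ G j ∧ ∀ i, i ≠ j → K i = G i

theorem flip_mem {S : Type*} (c : S → S) (hinv : ∀ s, c (c s) = s) (hnfix : ∀ s, c s ≠ s)
    (B : Set S) (hB : B ∈ ESet c) (b : S) : {s | s = c b ∨ (s ∈ B ∧ s ≠ b)} ∈ ESet c := by
  intro s
  have h1 := hB s
  have h2 := hinv s
  have h3 := hinv b
  have h4 := hnfix s
  have h5 := hnfix b
  simp only [Set.mem_setOf_eq, Xor', Xor] at *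
  grind

theorem letter_eq {S : Type*} (c : S → S) (hinv : ∀ s, c (c s) = s) (hnfix : ∀ s, c s ≠ s)
    (a b w : S) (B : Set S) (hB : B ∈ ESet c) (ha : a ∈ B) (hw : w ∈ B)
    (h : ∀ A ∈ ESet c, w ∈ A → (a ∈ A ↔ b ∈ A)) : a = b := by
  by_contra hab
  have hb : b ∈ B := (h B hB hw).1 ha
  have key : ∀ x, x ∉ {s | s = c x ∨ (s ∈ B ∧ s ≠ x)} := by
    intro x hx
    rcases hx with hx | hx
    · exact hnfix x hx.symm
    · exact hx.2 rfl
  by_cases hbw : b = w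
  · exact key a ((h _ (flip_mem c hinv hnfix B hB a)
      (Or.inr ⟨hw, fun e => hab (e.symm.trans hbw.symm)⟩)).2 (Or.inr ⟨hb, fun e => hab e.symm⟩))
  · exact key b ((h _ (flip_mem c hinv hnfix B hB b)
      (Or.inr ⟨hw, fun e => hbw e.symm⟩)).1 (Or.inr ⟨ha, hab⟩))

/-- Let `V ⊆ S^d` be a polybox code covering the word `w` with `w̆ ∩ v̆ ≠ ∅` for
every `v ∈ V`. If `V` contains no twin pair, then the suit `{w̆ ∩ v̆ : v ∈ V}` for
the box `w̆` contains no twin pair of boxes. -/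
theorem suit_of_cover_twin_pair_free {S : Type*} [Fintype S] [DecidableEq S]
    (c : S → S) (hinv : ∀ s, c (c s) = s) (hnfix : ∀ s, c s ≠ s)
    (d : ℕ) (w : Fin d → S) (V : Finset (Fin d → S))
    (hVcode : PolyboxCode c V) (hcover : Covered c w V)
    (hmeet : ∀ v ∈ V, (WordBox c w ∩ WordBox c v).Nonempty)
    (hVtp : TwinPairFree c V) :
    ∀ v ∈ V, ∀ u ∈ V,
      ¬ BoxTwinPair (fun i => LetterSet c (w i))
        (fun i => LetterSet c (v i) ∩ LetterSet c (w i))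
        (fun i => LetterSet c (u i) ∩ LetterSet c (w i)) := by
  rintro v hv u hu ⟨j, hj, hi⟩
  obtain ⟨x, hxw, hxv⟩ := hmeet v hv
  refine hVtp u hu v hv ⟨j, ?_, ?_⟩
  · refine letter_eq c hinv hnfix (v j) (c (u j)) (w j) (x j) (hxw j).1 (hxv j).2 (hxw j).2 ?_
    intro A hA hwA
    have h1 := Set.ext_iff.1 hj A
    have h2 := hA (u j)
    simp only [LetterSet, Set.mem_inter_iff, Set.mem_diff, Set.mem_setOf_eq, Xor', Xor] at h1 h2
    tauto
  · intro i hij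
    refine (letter_eq c hinv hnfix (v i) (u i) (w i) (x i) (hxw i).1 (hxv i).2 (hxw i).2 ?_).symm
    intro A hA hwA
    have h1 := Set.ext_iff.1 (hi i hij) A
    simp only [LetterSet, Set.mem_inter_iff, Set.mem_setOf_eq] at h1
    tauto
end
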